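/- arXiv:2605.25462 — 2 statements merged into one kernel-verified Lean document; each statement's English description precedes it below -/
import Mathlib

section
/- Let Λ ⊂ ℝ² be a lattice of covolume 1, let φ : ℝ² → ℝ be a smooth Λ-periodic function, and let v : [0,∞) × ℝ² → ℝ be a twice continuously differentiable, Λ-periodic solution of the Toda equation (e^v)_{ξξ} + v_{xx} + v_{yy} = 0 with v(0,·) = φ such that v − log(1+ξ) is bounded. Set φ̄ := log(⨏ e^φ). Then there exist constants a > 0, C > 0, and δ > 0 such that |v(ξ,x,y) − log(e^{φ̄} + a·ξ)| ≤ C·e^{−δ√ξ} for all ξ ≥ 0 and all (x,y) ∈ ℝ². -/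
open Real MeasureTheory

noncomputable section

/-- The average of a `Λ`-periodic function over the fundamental parallelogram of the
lattice spanned by `v1, v2` (of covolume 1, so there is no Jacobian factor). -/
def sliceAvg (v1 v2 : ℝ × ℝ) (f : ℝ → ℝ → ℝ) : ℝ :=
  ∫ s in (0:ℝ)..1, ∫ t in (0:ℝ)..1, f (s * v1.1 + t * v2.1) (s * v1.2 + t * v2.2)

/-- Periodicity with respect to the lattice generated by `v1, v2`. -/
def LatticePeriodic (v1 v2 : ℝ × ℝ) (f : ℝ → ℝ → ℝ) : Prop :=
  ∀ x y : ℝ, f (x + v1.1) (y + v1.2) = f x y ∧ f (x + v2.1) (y + v2.2) = f x y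

/-- The Toda operator `(e^v)_{ξξ} + v_{xx} + v_{yy}` evaluated at `(ξ,x,y)`. -/
def todaOp (v : ℝ → ℝ → ℝ → ℝ) (ξ x y : ℝ) : ℝ :=
  deriv (deriv (fun s => Real.exp (v s x y))) ξ +
    deriv (deriv (fun x' => v ξ x' y)) x + deriv (deriv (fun y' => v ξ x y')) y

/-- A C², Λ-periodic solution of the Toda equation on `[0,∞) × ℝ²` with boundary
value `φ` and logarithmic growth `v − log(1+ξ)` bounded (boundary value problem BVP2). -/
def IsSolBVP2 (v1 v2 : ℝ × ℝ) (φ : ℝ → ℝ → ℝ) (v : ℝ → ℝ → ℝ → ℝ) : Prop :=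
  ContDiff ℝ 2 (fun p : ℝ × ℝ × ℝ => v p.1 p.2.1 p.2.2) ∧
  (∃ M : ℝ, ∀ ξ ≥ (0:ℝ), ∀ x y : ℝ, |v ξ x y - Real.log (1 + ξ)| ≤ M) ∧
  (∀ ξ : ℝ, LatticePeriodic v1 v2 (v ξ)) ∧
  (∀ x y : ℝ, v 0 x y = φ x y) ∧
  (∀ ξ ≥ (0:ℝ), ∀ x y : ℝ, todaOp v ξ x y = 0)

/-- The slope condition `⨏ e^{v(ξ,·)} = ⨏ e^φ + aξ`. -/
def HasSlope (v1 v2 : ℝ × ℝ) (φ : ℝ → ℝ → ℝ) (a : ℝ) (v : ℝ → ℝ → ℝ → ℝ) : Prop :=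
  ∀ ξ ≥ (0:ℝ), sliceAvg v1 v2 (fun x y => Real.exp (v ξ x y)) =
    sliceAvg v1 v2 (fun x y => Real.exp (φ x y)) + a * ξ

section Torus

/-- The uniform probability measure on the unit square. -/
def unitSq : Measure (ℝ × ℝ) :=
  (volume.restrict (Set.Ioc (0:ℝ) 1)).prod (volume.restrict (Set.Ioc (0:ℝ) 1))

lemma isProb_Ioc : IsProbabilityMeasure (volume.restrict (Set.Ioc (0:ℝ) 1)) :=
  ⟨by simp⟩

instance : IsProbabilityMeasure unitSq := by
  have := isProb_Ioc
  unfold unitSq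
  infer_instance

lemma unitSq_eq : unitSq = volume.restrict (Set.Ioc (0:ℝ) 1 ×ˢ Set.Ioc (0:ℝ) 1) := by
  rw [unitSq, Measure.prod_restrict]; rfl

lemma integrable_unitSq {h : ℝ × ℝ → ℝ} (hh : Continuous h) : Integrable h unitSq := by
  rw [unitSq_eq]
  have : IntegrableOn h (Set.Icc (0:ℝ) 1 ×ˢ Set.Icc (0:ℝ) 1) volume :=
    hh.continuousOn.integrableOn_compact (isCompact_Icc.prod isCompact_Icc)
  exact this.mono_set (Set.prod_mono Set.Ioc_subset_Icc_self Set.Ioc_subset_Icc_self)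

lemma integral_unitSq {h : ℝ × ℝ → ℝ} (hh : Continuous h) :
    ∫ z, h z ∂unitSq = ∫ s in (0:ℝ)..1, ∫ t in (0:ℝ)..1, h (s, t) := by
  have := integrable_unitSq hh
  unfold unitSq at this ⊢
  rw [integral_prod _ this, intervalIntegral.integral_of_le zero_le_one]
  simp only [intervalIntegral.integral_of_le zero_le_one]

lemma integral_unitSq_symm {h : ℝ × ℝ → ℝ} (hh : Continuous h) :
    ∫ z, h z ∂unitSq = ∫ t in (0:ℝ)..1, ∫ s in (0:ℝ)..1, h (s, t) := by
  have := integrable_unitSq hh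
  unfold unitSq at this ⊢
  rw [integral_prod_symm _ this, intervalIntegral.integral_of_le zero_le_one]
  simp only [intervalIntegral.integral_of_le zero_le_one]

lemma sq_integral_le {α : Type*} [MeasurableSpace α] (μ : Measure α) [IsProbabilityMeasure μ]
    {f : α → ℝ} (hf : Integrable f μ) (hf2 : Integrable (fun x => f x ^ 2) μ) :
    (∫ x, f x ∂μ) ^ 2 ≤ ∫ x, f x ^ 2 ∂μ := by
  set c := ∫ x, f x ∂μ with hc
  have h0 : 0 ≤ ∫ x, (f x - c) ^ 2 ∂μ := integral_nonneg fun x => sq_nonneg _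
  have h1 : ∫ x, (f x - c) ^ 2 ∂μ = ∫ x, f x ^ 2 ∂μ - 2 * c * c + c ^ 2 := by
    have : ∀ x, (f x - c) ^ 2 = f x ^ 2 - 2 * c * f x + c ^ 2 := fun x => by ring
    simp only [this]
    have h2 : Integrable (fun x => 2 * c * f x) μ := hf.const_mul _
    have h3 : Integrable (fun x => f x ^ 2 - 2 * c * f x) μ := hf2.sub h2
    rw [integral_add h3 (integrable_const _), integral_sub hf2 h2, integral_const_mul, ← hc]
    simp
  nlinarith

lemma sq_intervalIntegral_le {f : ℝ → ℝ} (hf : Continuous f) :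
    (∫ x in (0:ℝ)..1, f x) ^ 2 ≤ ∫ x in (0:ℝ)..1, f x ^ 2 := by
  have := isProb_Ioc
  rw [intervalIntegral.integral_of_le zero_le_one, intervalIntegral.integral_of_le zero_le_one]
  have h1 : ∀ g : ℝ → ℝ, Continuous g → IntegrableOn g (Set.Ioc 0 1) volume := fun g hg =>
    (hg.continuousOn.integrableOn_compact isCompact_Icc).mono_set Set.Ioc_subset_Icc_self
  exact sq_integral_le _ (h1 _ hf) (h1 _ (hf.pow 2))

/-- On the unit interval a function varies by at most the integral of its derivative. -/
lemma abs_sub_le_integral_abs_deriv {h h' : ℝ → ℝ} (hd : ∀ x, HasDerivAt h (h' x) x)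
    (hc : Continuous h') {s σ : ℝ} (hs : s ∈ Set.Icc (0:ℝ) 1) (hσ : σ ∈ Set.Icc (0:ℝ) 1) :
    |h s - h σ| ≤ ∫ x in (0:ℝ)..1, |h' x| := by
  have e := intervalIntegral.integral_eq_sub_of_hasDerivAt (a := σ) (b := s) (f := h) (f' := h')
    (fun x _ => hd x) (hc.intervalIntegrable _ _)
  rw [← e]
  refine (intervalIntegral.norm_integral_le_integral_norm_uIoc (f := h') (μ := volume)).trans ?_
  rw [intervalIntegral.integral_of_le zero_le_one]
  refine setIntegral_mono_set ?_ (Filter.Eventually.of_forall fun x => abs_nonneg _) ?_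
  · exact ((hc.abs.continuousOn.integrableOn_compact isCompact_Icc).mono_set
      Set.Ioc_subset_Icc_self)
  · apply LE.le.eventuallyLE
    intro x hx
    rw [Set.uIoc, Set.mem_Ioc] at hx
    exact ⟨lt_of_le_of_lt (le_min hσ.1 hs.1) hx.1, hx.2.trans (max_le hσ.2 hs.2)⟩

lemma hasDerivAt_slice_fst {g : ℝ × ℝ → ℝ} (hg : ContDiff ℝ 1 g) (s t : ℝ) :
    HasDerivAt (fun s => g (s, t)) (fderiv ℝ g (s, t) (1, 0)) s := by
  have h1 := (hg.differentiable one_ne_zero (s, t)).hasFDerivAt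
  have h2 : HasDerivAt (fun s : ℝ => (s, t)) ((1:ℝ), (0:ℝ)) s :=
    (hasDerivAt_id s).prodMk (hasDerivAt_const s t)
  exact h1.comp_hasDerivAt s h2

lemma hasDerivAt_slice_snd {g : ℝ × ℝ → ℝ} (hg : ContDiff ℝ 1 g) (s t : ℝ) :
    HasDerivAt (fun t => g (s, t)) (fderiv ℝ g (s, t) (0, 1)) t := by
  have h1 := (hg.differentiable one_ne_zero (s, t)).hasFDerivAt
  have h2 : HasDerivAt (fun t : ℝ => (s, t)) ((0:ℝ), (1:ℝ)) t :=
    (hasDerivAt_const t s).prodMk (hasDerivAt_id t)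
  exact h1.comp_hasDerivAt t h2

lemma continuous_fderiv_apply' {E : Type*} [NormedAddCommGroup E] [NormedSpace ℝ E]
    {g : E → ℝ} (hg : ContDiff ℝ 1 g) (e : E) : Continuous fun z => fderiv ℝ g z e :=
  (hg.continuous_fderiv one_ne_zero).clm_apply continuous_const

/-- Functions on the plane with period `1` in both coordinates. -/
def UnitPeriodic (g : ℝ × ℝ → ℝ) : Prop :=
  ∀ s t : ℝ, g (s + 1, t) = g (s, t) ∧ g (s, t + 1) = g (s, t)

lemma fderiv_apply_eq (g : ℝ × ℝ → ℝ) (z e : ℝ × ℝ) :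
    fderiv ℝ g z e = e.1 * fderiv ℝ g z (1, 0) + e.2 * fderiv ℝ g z (0, 1) := by
  conv_lhs => rw [show e = e.1 • ((1:ℝ), (0:ℝ)) + e.2 • ((0:ℝ), (1:ℝ)) by ext <;> simp]
  rw [map_add, map_smul, map_smul]; rfl

lemma integral_fderiv_eq_zero {g : ℝ × ℝ → ℝ} (hg : ContDiff ℝ 1 g) (hp : UnitPeriodic g)
    (e : ℝ × ℝ) : ∫ z, fderiv ℝ g z e ∂unitSq = 0 := by
  have c := continuous_fderiv_apply' hg
  have h1 : ∫ z, fderiv ℝ g z (1, 0) ∂unitSq = 0 := by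
    rw [integral_unitSq_symm (c _)]
    have : ∀ t : ℝ, ∫ s in (0:ℝ)..1, fderiv ℝ g (s, t) (1, 0) = 0 := fun t => by
      rw [intervalIntegral.integral_eq_sub_of_hasDerivAt (f := fun s => g (s, t))
        (fun s _ => hasDerivAt_slice_fst hg s t)
        (((c _).comp (by fun_prop : Continuous fun s : ℝ => (s, t))).intervalIntegrable _ _)]
      have := (hp 0 t).1
      simp_all
    simp [this]
  have h2 : ∫ z, fderiv ℝ g z (0, 1) ∂unitSq = 0 := by
    rw [integral_unitSq (c _)]
    have : ∀ s : ℝ, ∫ t in (0:ℝ)..1, fderiv ℝ g (s, t) (0, 1) = 0 := fun s => by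
      rw [intervalIntegral.integral_eq_sub_of_hasDerivAt (f := fun t => g (s, t))
        (fun t _ => hasDerivAt_slice_snd hg s t)
        (((c _).comp (by fun_prop : Continuous fun t : ℝ => (s, t))).intervalIntegrable _ _)]
      have := (hp s 0).2
      simp_all
    simp [this]
  simp only [fderiv_apply_eq g _ e]
  rw [integral_add (((integrable_unitSq (c _))).const_mul _)
    (((integrable_unitSq (c _))).const_mul _), integral_const_mul, integral_const_mul, h1, h2]
  simp

/-- The Dirichlet energy of a function on the unit square. -/
def dirichlet (g : ℝ × ℝ → ℝ) : ℝ :=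
  ∫ z, (fderiv ℝ g z (1, 0) ^ 2 + fderiv ℝ g z (0, 1) ^ 2) ∂unitSq

lemma dirichlet_eq {g : ℝ × ℝ → ℝ} (hg : ContDiff ℝ 1 g) :
    dirichlet g = ∫ z, fderiv ℝ g z (1, 0) ^ 2 ∂unitSq + ∫ z, fderiv ℝ g z (0, 1) ^ 2 ∂unitSq :=
  integral_add (integrable_unitSq ((continuous_fderiv_apply' hg _).pow 2))
    (integrable_unitSq ((continuous_fderiv_apply' hg _).pow 2))

lemma integral_fst_unitSq {A : ℝ → ℝ} (hA : Continuous A) :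
    ∫ z, A z.1 ∂unitSq = ∫ s in (0:ℝ)..1, A s := by
  rw [integral_unitSq (by fun_prop)]; simp

lemma integral_snd_unitSq {A : ℝ → ℝ} (hA : Continuous A) :
    ∫ z, A z.2 ∂unitSq = ∫ s in (0:ℝ)..1, A s := by
  rw [integral_unitSq (by fun_prop)]; simp

lemma ae_unitSq {p : ℝ × ℝ → Prop}
    (h : ∀ s ∈ Set.Icc (0:ℝ) 1, ∀ t ∈ Set.Icc (0:ℝ) 1, p (s, t)) : ∀ᵐ z ∂unitSq, p z := by
  rw [unitSq_eq]
  refine (ae_restrict_iff' (measurableSet_Ioc.prod measurableSet_Ioc)).2 (.of_forall ?_)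
  rintro ⟨s, t⟩ ⟨hs, ht⟩
  exact h s (Set.Ioc_subset_Icc_self hs) t (Set.Ioc_subset_Icc_self ht)

lemma integral_unitSq_mono {f g : ℝ × ℝ → ℝ} (hf : Continuous f) (hg : Continuous g)
    (h : ∀ s ∈ Set.Icc (0:ℝ) 1, ∀ t ∈ Set.Icc (0:ℝ) 1, f (s, t) ≤ g (s, t)) :
    ∫ z, f z ∂unitSq ≤ ∫ z, g z ∂unitSq :=
  integral_mono_ae (integrable_unitSq hf) (integrable_unitSq hg) (ae_unitSq h)

lemma continuous_integral_fst {h : ℝ × ℝ → ℝ} (hh : Continuous h) :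
    Continuous fun t => ∫ s in (0:ℝ)..1, h (s, t) :=
  intervalIntegral.continuous_parametric_intervalIntegral_of_continuous'
    (f := fun t s => h (s, t)) (hh.comp continuous_swap) 0 1

lemma continuous_integral_snd {h : ℝ × ℝ → ℝ} (hh : Continuous h) :
    Continuous fun s => ∫ t in (0:ℝ)..1, h (s, t) :=
  intervalIntegral.continuous_parametric_intervalIntegral_of_continuous'
    (f := fun s t => h (s, t)) hh 0 1

/-- Poincaré inequality on the unit square. -/
lemma poincare_unitSq {g : ℝ × ℝ → ℝ} (hg : ContDiff ℝ 1 g) (h0 : ∫ z, g z ∂unitSq = 0) :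
    ∫ z, g z ^ 2 ∂unitSq ≤ 2 * dirichlet g := by
  have c := continuous_fderiv_apply' hg
  set A : ℝ → ℝ := fun t => ∫ s in (0:ℝ)..1, |fderiv ℝ g (s, t) (1, 0)| with hA
  set B : ℝ → ℝ := fun s => ∫ t in (0:ℝ)..1, |fderiv ℝ g (s, t) (0, 1)| with hB
  have cA : Continuous A := continuous_integral_fst (c _).abs
  have cB : Continuous B := continuous_integral_snd (c _).abs
  have hAB : ∀ s ∈ Set.Icc (0:ℝ) 1, ∀ t ∈ Set.Icc (0:ℝ) 1, ∀ s' ∈ Set.Icc (0:ℝ) 1,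
      ∀ t' ∈ Set.Icc (0:ℝ) 1, |g (s, t) - g (s', t')| ≤ A t + B s' := by
    intro s hs t ht s' hs' t' ht'
    have h1 := abs_sub_le_integral_abs_deriv (fun x => hasDerivAt_slice_fst hg x t)
      ((c _).comp (by fun_prop : Continuous fun s : ℝ => (s, t))) hs hs'
    have h2 := abs_sub_le_integral_abs_deriv (fun x => hasDerivAt_slice_snd hg s' x)
      ((c _).comp (by fun_prop : Continuous fun t : ℝ => (s', t))) ht ht'
    exact (abs_sub_le _ (g (s', t)) _).trans (add_le_add h1 h2)
  have hb : ∀ s ∈ Set.Icc (0:ℝ) 1, ∀ t ∈ Set.Icc (0:ℝ) 1,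
      |g (s, t)| ≤ A t + ∫ x in (0:ℝ)..1, B x := by
    intro s hs t ht
    have e : g (s, t) = ∫ z, (g (s, t) - g z) ∂unitSq := by
      rw [integral_sub (integrable_const _) (integrable_unitSq hg.continuous), h0]; simp
    have e2 : A t + ∫ x in (0:ℝ)..1, B x = ∫ z, (A t + B z.1) ∂unitSq := by
      rw [integral_add (integrable_const _) (integrable_unitSq (by fun_prop)),
        integral_fst_unitSq cB]; simp
    rw [e, e2]
    refine (abs_integral_le_integral_abs).trans ?_
    refine integral_unitSq_mono (by have := hg.continuous; fun_prop) (by fun_prop) ?_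
    intro s' hs' t' ht'
    exact hAB s hs t ht s' hs' t' ht'
  have hsq : ∫ z, g z ^ 2 ∂unitSq ≤
      ∫ z : ℝ × ℝ, (2 * A z.2 ^ 2 + 2 * (∫ x in (0:ℝ)..1, B x) ^ 2) ∂unitSq := by
    refine integral_unitSq_mono (hg.continuous.pow 2) (by fun_prop) ?_
    intro s hs t ht
    have := hb s hs t ht
    rw [← sq_abs]
    have h3 : |g (s, t)| ^ 2 ≤ (A t + ∫ x in (0:ℝ)..1, B x) ^ 2 :=
      pow_le_pow_left₀ (abs_nonneg _) this 2
    dsimp only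
    nlinarith [sq_nonneg (A t - ∫ x in (0:ℝ)..1, B x)]
  have hA2 : ∫ t in (0:ℝ)..1, A t ^ 2 ≤ ∫ z, fderiv ℝ g z (1, 0) ^ 2 ∂unitSq := by
    rw [integral_unitSq_symm (h := fun z => fderiv ℝ g z (1, 0) ^ 2) ((c _).pow 2)]
    refine intervalIntegral.integral_mono zero_le_one ((cA.pow 2).intervalIntegrable _ _)
      ((continuous_integral_fst ((c (1, 0)).pow 2)).intervalIntegrable _ _) fun t => ?_
    simpa using sq_intervalIntegral_le
      (((c (1, 0)).comp (by fun_prop : Continuous fun s : ℝ => (s, t))).abs)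
  have hB2 : (∫ s in (0:ℝ)..1, B s) ^ 2 ≤ ∫ z, fderiv ℝ g z (0, 1) ^ 2 ∂unitSq := by
    rw [hB, ← integral_unitSq (c _).abs]
    simpa using sq_integral_le unitSq (integrable_unitSq (c (0, 1)).abs)
      (integrable_unitSq ((c (0, 1)).abs.pow 2))
  rw [integral_add (integrable_unitSq (by fun_prop)) (integrable_const _), integral_const_mul,
    integral_snd_unitSq (A := fun t => A t ^ 2) (cA.pow 2)] at hsq
  simp only [integral_const, probReal_univ, one_smul] at hsq
  rw [dirichlet_eq hg]
  linarith

/-- Sobolev inequality (`H¹ ⊂ L⁴`) on the unit square. -/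
lemma sobolev_unitSq {g : ℝ × ℝ → ℝ} (hg : ContDiff ℝ 1 g) :
    ∫ z, g z ^ 4 ∂unitSq ≤ (2 * ∫ z, g z ^ 2 ∂unitSq + dirichlet g) ^ 2 := by
  have c := continuous_fderiv_apply' hg
  have cg := hg.continuous
  set X := ∫ z, g z ^ 2 ∂unitSq with hX
  set a : ℝ × ℝ → ℝ := fun z => 2 * g z ^ 2 + fderiv ℝ g z (1, 0) ^ 2 with ha
  set b : ℝ × ℝ → ℝ := fun z => 2 * g z ^ 2 + fderiv ℝ g z (0, 1) ^ 2 with hb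
  have ca : Continuous a := ((cg.pow 2).const_mul 2).add ((c _).pow 2)
  have cb : Continuous b := ((cg.pow 2).const_mul 2).add ((c _).pow 2)
  have key : ∀ (h h' : ℝ → ℝ), (∀ x, HasDerivAt h (h' x) x) → Continuous h' →
      ∀ s ∈ Set.Icc (0:ℝ) 1, h s ^ 2 ≤ ∫ x in (0:ℝ)..1, (2 * h x ^ 2 + h' x ^ 2) := by
    intro h h' hd hc s hs
    have ch : Continuous h := continuous_iff_continuousAt.2 fun x => (hd x).continuousAt
    have i1 : ∀ f : ℝ → ℝ, Continuous f → IntervalIntegrable f volume 0 1 :=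
      fun f hf => hf.intervalIntegrable _ _
    have h1 : ∀ σ ∈ Set.Icc (0:ℝ) 1,
        h s ^ 2 - ∫ x in (0:ℝ)..1, |2 * h x * h' x| ≤ h σ ^ 2 := by
      intro σ hσ
      have := abs_sub_le_integral_abs_deriv (h := fun x => h x ^ 2)
        (h' := fun x => 2 * h x * h' x) (fun x => by simpa using (hd x).fun_pow 2) (by fun_prop) hs hσ
      linarith [(abs_le.1 this).2]
    have h2 := intervalIntegral.integral_mono_on zero_le_one (intervalIntegrable_const)
      (i1 _ (ch.pow 2)) h1
    simp only [intervalIntegral.integral_const, sub_zero, one_smul, Pi.pow_apply] at h2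
    have h3 : ∫ x in (0:ℝ)..1, |2 * h x * h' x| ≤ ∫ x in (0:ℝ)..1, (h x ^ 2 + h' x ^ 2) := by
      refine intervalIntegral.integral_mono zero_le_one (i1 _ (by fun_prop)) (i1 _ (by fun_prop))
        fun x => ?_
      exact abs_le.2 ⟨by nlinarith [sq_nonneg (h x + h' x)], by nlinarith [sq_nonneg (h x - h' x)]⟩
    rw [intervalIntegral.integral_add (i1 _ (by fun_prop)) (i1 _ (by fun_prop))] at h3 ⊢
    rw [intervalIntegral.integral_const_mul]
    linarith
  have hpt : ∀ s ∈ Set.Icc (0:ℝ) 1, ∀ t ∈ Set.Icc (0:ℝ) 1,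
      g (s, t) ^ 4 ≤ (∫ x in (0:ℝ)..1, b (s, x)) * ∫ x in (0:ℝ)..1, a (x, t) := by
    intro s hs t ht
    have h1 := key _ _ (fun x => hasDerivAt_slice_fst hg x t)
      ((c _).comp (by fun_prop : Continuous fun s : ℝ => (s, t))) s hs
    have h2 := key _ _ (fun x => hasDerivAt_slice_snd hg s x)
      ((c _).comp (by fun_prop : Continuous fun t : ℝ => (s, t))) t ht
    calc g (s, t) ^ 4 = g (s, t) ^ 2 * g (s, t) ^ 2 := by ring
      _ ≤ _ := mul_le_mul h2 h1 (sq_nonneg _) ((sq_nonneg _).trans h2)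
  have cA := continuous_integral_fst ca
  have cB := continuous_integral_snd cb
  have h1 := integral_unitSq_mono (f := fun z => g z ^ 4)
    (g := fun z => (∫ x in (0:ℝ)..1, b (z.1, x)) * ∫ x in (0:ℝ)..1, a (x, z.2))
    (cg.pow 4) (by fun_prop) hpt
  rw [integral_unitSq (h := fun z => (∫ x in (0:ℝ)..1, b (z.1, x)) * ∫ x in (0:ℝ)..1, a (x, z.2))
    (by fun_prop)] at h1
  simp only [intervalIntegral.integral_const_mul, intervalIntegral.integral_mul_const] at h1
  have split : ∀ e, ∫ z, (2 * g z ^ 2 + fderiv ℝ g z e ^ 2) ∂unitSq =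
      2 * X + ∫ z, fderiv ℝ g z e ^ 2 ∂unitSq := fun e => by
    have h2 : Integrable (fun z => fderiv ℝ g z e ^ 2) unitSq := integrable_unitSq ((c e).pow 2)
    rw [integral_add (integrable_unitSq (by fun_prop)) h2, integral_const_mul]
  rw [← integral_unitSq_symm ca, ← integral_unitSq cb, ha, hb, split, split] at h1
  rw [dirichlet_eq hg]
  have p0 : 0 ≤ X := integral_nonneg fun z => sq_nonneg _
  have p1 : 0 ≤ ∫ z, fderiv ℝ g z (1, 0) ^ 2 ∂unitSq := integral_nonneg fun z => sq_nonneg _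
  have p2 : 0 ≤ ∫ z, fderiv ℝ g z (0, 1) ^ 2 ∂unitSq := integral_nonneg fun z => sq_nonneg _
  refine h1.trans ?_
  rw [sq]
  exact mul_le_mul (by linarith) (by linarith) (by positivity) (by positivity)

end Torus

section ODE

/-- A function that is strictly convex wherever it is positive, nonpositive at `0` and
nonpositive arbitrarily far out, is nonpositive on the half-line. -/
lemma nonpos_of_convex_where_pos {h h1 h2 : ℝ → ℝ} (hd : ∀ x ≥ 0, HasDerivAt h (h1 x) x)
    (hd1 : ∀ x ≥ 0, HasDerivAt h1 (h2 x) x) (hpos : ∀ x > 0, 0 < h x → 0 < h2 x) (h0 : h 0 ≤ 0)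
    (hinf : ∀ x, ∃ y > x, h y ≤ 0) {x : ℝ} (hx : 0 ≤ x) : h x ≤ 0 := by
  by_contra! hc
  obtain ⟨R, hR, hR0⟩ := hinf x
  obtain ⟨m, hm, hmax⟩ := isCompact_Icc.exists_isMaxOn (⟨x, hx, hR.le⟩ : (Set.Icc 0 R).Nonempty)
    (fun y hy => (hd y hy.1).continuousAt.continuousWithinAt)
  have hmx : 0 < h m := hc.trans_le (hmax ⟨hx, hR.le⟩)
  have m0 : 0 < m := lt_of_le_of_ne hm.1 (by rintro rfl; linarith)
  have mR : m < R := lt_of_le_of_ne hm.2 (by rintro rfl; linarith)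
  have hloc : IsLocalMax h m := hmax.isLocalMax (Icc_mem_nhds m0 mR)
  have e1 : deriv h =ᶠ[nhds m] h1 := by
    filter_upwards [lt_mem_nhds m0] with y hy using (hd y hy.le).deriv
  have e2 : deriv (deriv h) m = h2 m := by rw [e1.deriv_eq, (hd1 m m0.le).deriv]
  have hmin : IsLocalMin h m := isLocalMin_of_deriv_deriv_pos
    (by rw [e2]; exact hpos m m0 hmx) hloc.deriv_eq_zero (hd m m0.le).continuousAt
  have hconst : h =ᶠ[nhds m] fun _ => h m := by
    filter_upwards [hloc, hmin] with y a b using le_antisymm a b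
  have h3 := hconst.deriv.deriv_eq
  have := hpos m m0 hmx
  simp [e2] at h3
  linarith

lemma hasDerivAt_exp_mul_sqrt (c : ℝ) {x : ℝ} (hx : 0 < 1 + x) :
    HasDerivAt (fun x => exp (c * √(1 + x)))
      (exp (c * √(1 + x)) * (c * (1 / (2 * √(1 + x))))) x := by
  have h1 : HasDerivAt (fun x : ℝ => √(1 + x)) (1 / (2 * √(1 + x))) x :=
    ((hasDerivAt_id x).const_add 1).sqrt hx.ne'
  exact (h1.const_mul c).exp

lemma hasDerivAt_exp_mul_sqrt' (c : ℝ) {x : ℝ} (hx : 0 < 1 + x) :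
    HasDerivAt (fun x => exp (c * √(1 + x)) * (c * (1 / (2 * √(1 + x)))))
      (exp (c * √(1 + x)) * ((c ^ 2 - c / √(1 + x)) / (4 * (1 + x)))) x := by
  have h1 : HasDerivAt (fun x : ℝ => √(1 + x)) (1 / (2 * √(1 + x))) x :=
    ((hasDerivAt_id x).const_add 1).sqrt hx.ne'
  have hs : 0 < √(1 + x) := Real.sqrt_pos.2 hx
  have h2 := ((h1.const_mul 2).inv (by positivity)).const_mul c
  have h3 := (hasDerivAt_exp_mul_sqrt c hx).mul h2
  simp only [one_div]
  refine h3.congr_deriv ?_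
  have e : √(1 + x) ^ 2 = 1 + x := Real.sq_sqrt hx.le
  simp only [Pi.inv_apply]
  rw [← e, Real.sqrt_sq hs.le]
  field_simp
  ring

/-- Nonnegative solutions of `G'' ≥ κ G / (1 + ξ)` of at most quadratic growth decay like
`exp (-δ √ξ)`. -/
lemma decay_of_deriv2_ge {G G1 G2 : ℝ → ℝ} (hd : ∀ x, HasDerivAt G (G1 x) x)
    (hd1 : ∀ x, HasDerivAt G1 (G2 x) x) {κ δ B : ℝ} (hδ : 0 < δ) (hδ1 : δ ≤ 1) (hδκ : δ ≤ κ)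
    (hode : ∀ x ≥ 0, κ / (1 + x) * G x ≤ G2 x) (h0 : 0 ≤ G 0)
    (hB : ∀ x ≥ 0, G x ≤ B * (1 + x) ^ 2) {x : ℝ} (hx : 0 ≤ x) :
    G x ≤ G 0 * exp δ * exp (-δ * √(1 + x)) := by
  have bound : ∀ c : ℝ, |c| = δ → ∀ x ≥ 0,
      exp (c * √(1 + x)) * ((c ^ 2 - c / √(1 + x)) / (4 * (1 + x))) ≤
        κ / (1 + x) * exp (c * √(1 + x)) := by
    intro c hc x hx
    have h1 : 1 ≤ √(1 + x) := Real.one_le_sqrt.2 (by linarith)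
    have h2 : -c / √(1 + x) ≤ δ := by
      rw [div_le_iff₀ (by linarith)]
      nlinarith [neg_abs_le c]
    have h3 : c ^ 2 ≤ δ := by rw [← sq_abs, hc]; nlinarith
    rw [mul_comm]
    refine mul_le_mul_of_nonneg_right ?_ (exp_pos _).le
    rw [div_le_div_iff₀ (by linarith) (by linarith)]
    have : c ^ 2 - c / √(1 + x) ≤ 2 * δ := by rw [neg_div] at h2; linarith
    nlinarith
  set a := G 0 * exp δ with ha
  have ha0 : 0 ≤ a := by positivity
  have main : ∀ ε > 0, G x ≤ a * exp (-δ * √(1 + x)) + ε * exp (δ * √(1 + x)) := by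
    intro ε hε
    have := nonpos_of_convex_where_pos
      (h := fun x => G x - a * exp (-δ * √(1 + x)) - ε * exp (δ * √(1 + x)))
      (fun x hx => ((hd x).sub ((hasDerivAt_exp_mul_sqrt (-δ) (by linarith)).const_mul a)).sub
        ((hasDerivAt_exp_mul_sqrt δ (by linarith)).const_mul ε))
      (fun x hx => ((hd1 x).sub ((hasDerivAt_exp_mul_sqrt' (-δ) (by linarith)).const_mul a)).sub
        ((hasDerivAt_exp_mul_sqrt' δ (by linarith)).const_mul ε)) ?_ ?_ ?_ hx
    · linarith
    · intro y hy hpos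
      have b1 := mul_le_mul_of_nonneg_left (bound (-δ) (by rw [abs_neg, abs_of_pos hδ]) y hy.le) ha0
      have b2 := mul_le_mul_of_nonneg_left (bound δ (abs_of_pos hδ) y hy.le) hε.le
      have b3 := hode y hy.le
      have hk : 0 < κ / (1 + y) := div_pos (by linarith) (by linarith)
      have b4 := mul_pos hk hpos
      nlinarith
    · have : a * exp (-δ) = G 0 := by rw [ha, mul_assoc, ← exp_add]; simp
      have := mul_pos hε (exp_pos δ)
      simp only [add_zero, Real.sqrt_one, mul_one]
      linarith
    · intro y
      set W := 120 * |B| / (ε * δ ^ 5) with hW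
      have hW0 : 0 ≤ W := by positivity
      refine ⟨|y| + 1 + W ^ 2, by nlinarith [le_abs_self y], ?_⟩
      set u := |y| + 1 + W ^ 2 with hu
      have hu0 : 0 ≤ u := by positivity
      set w := √(1 + u) with hw
      have hw0 : 0 ≤ w := Real.sqrt_nonneg _
      have hWw : W ≤ w := Real.le_sqrt_of_sq_le (by nlinarith [abs_nonneg y])
      have hw2 : w ^ 2 = 1 + u := Real.sq_sqrt (by linarith)
      have e1 := Real.pow_div_factorial_le_exp (δ * w) (by positivity) 5
      have e2 := hB u hu0
      have e3 : B * (1 + u) ^ 2 ≤ ε * exp (δ * w) := by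
        calc B * (1 + u) ^ 2 = B * w ^ 4 := by rw [← hw2]; ring
          _ ≤ |B| * w ^ 4 := by gcongr; exact le_abs_self B
          _ = ε * δ ^ 5 / 120 * W * w ^ 4 := by rw [hW]; field_simp
          _ ≤ ε * δ ^ 5 / 120 * w * w ^ 4 := by gcongr
          _ = ε * ((δ * w) ^ 5 / (Nat.factorial 5 : ℝ)) := by
            norm_num [Nat.factorial]; ring
          _ ≤ _ := by gcongr
      have e4 : 0 ≤ a * exp (-δ * w) := by positivity
      linarith
  refine le_of_forall_pos_le_add fun ε hε => ?_
  have := main (ε / exp (δ * √(1 + x))) (by positivity)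
  rwa [div_mul_cancel₀ _ (exp_pos _).ne'] at this

lemma exists_deriv2_le {G G1 G2 : ℝ → ℝ} (hd : ∀ x, HasDerivAt G (G1 x) x)
    (hd1 : ∀ x, HasDerivAt G1 (G2 x) x) {p L S : ℝ} (hL : 0 < L)
    (h2 : ∀ x ∈ Set.Icc p (p + 3 * L), 0 ≤ G2 x) (h0 : ∀ x ∈ Set.Icc p (p + 3 * L), 0 ≤ G x)
    (hS : ∀ x ∈ Set.Icc p (p + 3 * L), G x ≤ S) :
    ∃ x ∈ Set.Icc (p + L) (p + 2 * L), G2 x ≤ 2 * S / L ^ 2 := by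
  have c0 : Continuous G := continuous_iff_continuousAt.2 fun x => (hd x).continuousAt
  have c1 : Continuous G1 := continuous_iff_continuousAt.2 fun x => (hd1 x).continuousAt
  have mono : MonotoneOn G1 (Set.Icc p (p + 3 * L)) := by
    refine monotoneOn_of_deriv_nonneg (convex_Icc _ _) c1.continuousOn
      (fun x _ => (hd1 x).differentiableAt.differentiableWithinAt) fun x hx => ?_
    rw [(hd1 x).deriv]
    exact h2 x (interior_subset hx)
  obtain ⟨x, hx, hx'⟩ := exists_hasDerivAt_eq_slope G1 G2 (by linarith : p + L < p + 2 * L)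
    c1.continuousOn fun x _ => hd1 x
  obtain ⟨y, hy, hy'⟩ := exists_hasDerivAt_eq_slope G G1 (by linarith : p < p + L)
    c0.continuousOn fun x _ => hd x
  obtain ⟨w, hw, hw'⟩ := exists_hasDerivAt_eq_slope G G1
    (by linarith : p + 2 * L < p + 3 * L) c0.continuousOn fun x _ => hd x
  have m1 : G1 y ≤ G1 (p + L) := mono ⟨hy.1.le, by linarith [hy.2]⟩ ⟨by linarith, by linarith⟩ hy.2.le
  have m2 : G1 (p + 2 * L) ≤ G1 w :=
    mono ⟨by linarith, by linarith⟩ ⟨by linarith [hw.1], hw.2.le⟩ hw.1.le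
  refine ⟨x, Set.Ioo_subset_Icc_self hx, ?_⟩
  have b1 : -(S / L) ≤ G1 y := by
    rw [hy', ← neg_div]
    have := h0 (p + L) ⟨by linarith, by linarith⟩
    have := hS p ⟨by linarith, by linarith⟩
    rw [show p + L - p = L by ring]
    gcongr; linarith
  have b2 : G1 w ≤ S / L := by
    rw [hw', show p + 3 * L - (p + 2 * L) = L by ring]
    have := h0 (p + 2 * L) ⟨by linarith, by linarith⟩
    have := hS (p + 3 * L) ⟨by linarith, by linarith⟩
    gcongr; linarith
  rw [hx', show p + 2 * L - (p + L) = L by ring, div_le_div_iff₀ hL (by positivity)]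
  have e : S / L * L = S := by field_simp
  nlinarith [mul_le_mul_of_nonneg_right (show G1 (p + 2 * L) - G1 (p + L) ≤ 2 * (S / L) by linarith)
    (sq_nonneg L)]

lemma le_of_deriv2_nonneg {G G1 G2 : ℝ → ℝ} (hd : ∀ x, HasDerivAt G (G1 x) x)
    (hd1 : ∀ x, HasDerivAt G1 (G2 x) x) {a b S : ℝ}
    (h2 : ∀ x ∈ Set.Icc a b, 0 ≤ G2 x) (ha : G a ≤ S) (hb : G b ≤ S) {x : ℝ}
    (hx : x ∈ Set.Icc a b) : G x ≤ S := by
  have c0 : Continuous G := continuous_iff_continuousAt.2 fun x => (hd x).continuousAt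
  have e0 : deriv G = G1 := funext fun x => (hd x).deriv
  have hc : ConvexOn ℝ (Set.Icc a b) G := by
    refine convexOn_of_deriv2_nonneg (convex_Icc _ _) c0.continuousOn
      (fun x _ => (hd x).differentiableAt.differentiableWithinAt)
      (fun x _ => by rw [e0]; exact (hd1 x).differentiableAt.differentiableWithinAt) fun x hx => ?_
    simp only [Function.iterate_succ, Function.iterate_zero, Function.comp_apply, id_eq, e0,
      (hd1 x).deriv]
    exact h2 x (interior_subset hx)
  have hab := hx.1.trans hx.2
  exact (hc.le_max_of_mem_Icc ⟨le_rfl, hab⟩ ⟨hab, le_rfl⟩ hx).trans (max_le ha hb)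

/-- Moser iteration for a sequence of nonnegative convex functions, each controlled by the
square of the previous one and its second derivative. -/
lemma moser_iteration {G G1 G2 : ℕ → ℝ → ℝ} (hd : ∀ k x, HasDerivAt (G k) (G1 k x) x)
    (hd1 : ∀ k x, HasDerivAt (G1 k) (G2 k x) x) {c R S : ℝ} (hR : 1 ≤ R)
    (h0 : ∀ k x, 0 ≤ G k x)
    (h2 : ∀ k, ∀ x ∈ Set.Icc (c - 2) (c + 2), 0 ≤ G2 k x)
    (hstep : ∀ k, ∀ x ∈ Set.Icc (c - 2) (c + 2), G (k + 1) x ≤ (R * (G k x + G2 k x)) ^ 2)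
    (hS : ∀ x ∈ Set.Icc (c - 2) (c + 2), G 0 x ≤ S) (k : ℕ) :
    G k c ≤ (16 * (33 * R) ^ 2 * S) ^ 2 ^ k := by
  have hS0 : 0 ≤ S := (h0 0 c).trans (hS c ⟨by linarith, by linarith⟩)
  set Q := 33 * R with hQ
  have main : ∀ k : ℕ, ∀ x ∈ Set.Icc (c - 2 * (1 / 2) ^ k) (c + 2 * (1 / 2) ^ k),
      Q ^ 2 * 16 ^ (k + 1) * G k x ≤ (16 * Q ^ 2 * S) ^ 2 ^ k := by
    intro k
    induction k with
    | zero =>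
      intro x hx
      have := hS x (by simpa using hx)
      simp only [zero_add, pow_one, pow_zero]
      nlinarith [mul_le_mul_of_nonneg_left this (sq_nonneg Q)]
    | succ k ih =>
      set L : ℝ := (1 / 2) ^ k / 2 with hL
      have hL0 : 0 < L := by positivity
      have hp1 : ((1:ℝ) / 2) ^ k ≤ 1 := pow_le_one₀ (by norm_num) (by norm_num)
      have er : ((1:ℝ) / 2) ^ k = 2 * L := by rw [hL]; ring
      have er' : ((1:ℝ) / 2) ^ (k + 1) = L := by rw [pow_succ, hL]; ring
      have eL : L ^ 2 * 4 * 4 ^ k = 1 := by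
        rw [hL, div_pow, ← pow_mul, mul_comm k 2, pow_mul]
        have : ((1:ℝ) / 2) ^ 2 = 1 / 4 := by norm_num
        rw [this, one_div, inv_pow, show (2:ℝ) ^ 2 = 4 by norm_num]
        field_simp
      rw [er] at ih hp1
      rw [er']
      set T := (16 * Q ^ 2 * S) ^ 2 ^ k / (Q ^ 2 * 16 ^ (k + 1)) with hT
      have hQ0 : 0 < Q := by positivity
      have hG : ∀ x ∈ Set.Icc (c - 4 * L) (c + 4 * L), G k x ≤ T := fun x hx => by
        rw [hT, le_div_iff₀ (by positivity), mul_comm]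
        exact ih x ⟨by linarith [hx.1], by linarith [hx.2]⟩
      have hT0 : 0 ≤ T := (h0 k c).trans (hG c ⟨by linarith, by linarith⟩)
      have good : ∀ p, c - 4 * L ≤ p → p + 3 * L ≤ c + 4 * L →
          ∃ x ∈ Set.Icc (p + L) (p + 2 * L), G (k + 1) x ≤ (Q * 4 ^ k * T) ^ 2 := by
        intro p hp hp'
        have sub : ∀ x ∈ Set.Icc p (p + 3 * L), x ∈ Set.Icc (c - 4 * L) (c + 4 * L) :=
          fun x hx => ⟨by linarith [hx.1], by linarith [hx.2]⟩
        have sub' : ∀ x ∈ Set.Icc (c - 4 * L) (c + 4 * L), x ∈ Set.Icc (c - 2) (c + 2) :=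
          fun x hx => ⟨by linarith [hx.1], by linarith [hx.2]⟩
        obtain ⟨x, hx, hx'⟩ := exists_deriv2_le (hd k) (hd1 k) (p := p) hL0
          (fun x hx => h2 k x (sub' _ (sub x hx))) (fun x hx => h0 k x)
          (fun x hx => hG x (sub x hx))
        have hxs : x ∈ Set.Icc p (p + 3 * L) := ⟨by linarith [hx.1], by linarith [hx.2]⟩
        refine ⟨x, hx, (hstep k x (sub' _ (sub x hxs))).trans ?_⟩
        have n1 := h0 k x
        have n2 := h2 k x (sub' _ (sub x hxs))
        have n3 : 2 * T / L ^ 2 = 8 * 4 ^ k * T := by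
          rw [div_eq_iff (by positivity)]
          linear_combination (-2 * T) * eL
        have n4 : (1:ℝ) ≤ 4 ^ k := one_le_pow₀ (by norm_num)
        have n5 : G k x + G2 k x ≤ 33 * (4 ^ k * T) := by
          have := hG x (sub x hxs)
          nlinarith [mul_le_mul_of_nonneg_right n4 hT0, mul_nonneg (by positivity : (0:ℝ) ≤ 4 ^ k) hT0]
        refine pow_le_pow_left₀ (by positivity) ?_ 2
        calc R * (G k x + G2 k x) ≤ R * (33 * (4 ^ k * T)) := by gcongr
          _ = Q * 4 ^ k * T := by rw [hQ]; ring
      obtain ⟨a, ha, ha'⟩ := good (c - 4 * L) le_rfl (by linarith)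
      obtain ⟨b, hb, hb'⟩ := good (c + L) (by linarith) (by linarith)
      intro x hx
      have := le_of_deriv2_nonneg (hd (k + 1)) (hd1 (k + 1)) (a := a) (b := b)
        (fun y hy => h2 _ y ⟨by linarith [hy.1, ha.1], by linarith [hy.2, hb.2]⟩) ha' hb'
        ⟨by linarith [hx.1, ha.2], by linarith [hx.2, hb.1]⟩ (x := x)
      calc Q ^ 2 * 16 ^ (k + 1 + 1) * G (k + 1) x
          ≤ Q ^ 2 * 16 ^ (k + 1 + 1) * (Q * 4 ^ k * T) ^ 2 := by gcongr
        _ = (Q ^ 2 * 16 ^ (k + 1) * T) ^ 2 := by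
          have : (16:ℝ) ^ k = (4 ^ k) ^ 2 := by rw [← pow_mul, mul_comm, pow_mul]; norm_num
          rw [pow_succ 16 (k + 1), pow_succ 16 k, this]; ring
        _ = (16 * Q ^ 2 * S) ^ 2 ^ (k + 1) := by
          rw [hT, mul_div_cancel₀ _ (by positivity), ← pow_mul, ← pow_succ]
  have h1 := main k c ⟨by linarith [show (0:ℝ) ≤ (1 / 2) ^ k by positivity],
    by linarith [show (0:ℝ) ≤ (1 / 2) ^ k by positivity]⟩
  refine le_trans ?_ h1
  have : (1:ℝ) ≤ Q ^ 2 * 16 ^ (k + 1) := by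
    have a1 : (1:ℝ) ≤ Q ^ 2 := one_le_pow₀ (by linarith)
    have a2 : (1:ℝ) ≤ 16 ^ (k + 1) := one_le_pow₀ (by norm_num)
    nlinarith
  nlinarith [h0 k c]

end ODE

section Toda

lemma hasDerivAt_integral_unitSq {h h' : ℝ → ℝ × ℝ → ℝ}
    (hd : ∀ ξ z, HasDerivAt (fun ξ => h ξ z) (h' ξ z) ξ) (hc : ∀ ξ, Continuous (h ξ))
    (hc' : Continuous (Function.uncurry h')) (ξ : ℝ) :
    HasDerivAt (fun ξ => ∫ z, h ξ z ∂unitSq) (∫ z, h' ξ z ∂unitSq) ξ := by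
  obtain ⟨C, hC⟩ := ((isCompact_Icc (a := ξ - 1) (b := ξ + 1)).prod
    ((isCompact_Icc (a := (0:ℝ)) (b := 1)).prod
      (isCompact_Icc (a := (0:ℝ)) (b := 1)))).exists_bound_of_continuousOn hc'.continuousOn
  have cξ : Continuous (h' ξ) := hc'.comp (by fun_prop : Continuous fun z : ℝ × ℝ => (ξ, z))
  refine (hasDerivAt_integral_of_dominated_loc_of_deriv_le (bound := fun _ => C)
    (Icc_mem_nhds (by linarith : ξ - 1 < ξ) (by linarith : ξ < ξ + 1))
    (.of_forall fun x => (integrable_unitSq (hc x)).aestronglyMeasurable)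
    (integrable_unitSq (hc ξ)) (integrable_unitSq cξ).aestronglyMeasurable ?_
    (integrable_const _) (.of_forall fun z x _ => hd x z)).2
  exact ae_unitSq fun s hs t ht x hx => hC (x, s, t) ⟨hx, hs, ht⟩

lemma UnitPeriodic.fderiv_apply {g : ℝ × ℝ → ℝ} (hp : UnitPeriodic g) (e : ℝ × ℝ) :
    UnitPeriodic fun z => fderiv ℝ g z e := by
  have h1 : ∀ w : ℝ × ℝ, (∀ z, g (z + w) = g z) → ∀ z, fderiv ℝ g (z + w) e = fderiv ℝ g z e := by
    intro w hw z
    rw [← fderiv_comp_add_right w]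
    simp only [hw]
  intro s t
  constructor
  · simpa using h1 (1, 0) (by rintro ⟨s, t⟩; simpa using (hp s t).1) (s, t)
  · simpa using h1 (0, 1) (by rintro ⟨s, t⟩; simpa using (hp s t).2) (s, t)

lemma contDiff_fderiv_apply' {E : Type*} [NormedAddCommGroup E] [NormedSpace ℝ E]
    {g : E → ℝ} (hg : ContDiff ℝ 2 g) (e : E) :
    ContDiff ℝ 1 fun z => fderiv ℝ g z e :=
  (hg.fderiv_right (m := 1) (by norm_num)).clm_apply contDiff_const

/-- The iterated directional derivative. -/
def dirDeriv2 {E : Type*} [NormedAddCommGroup E] [NormedSpace ℝ E] (e : E) (g : E → ℝ) (z : E) :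
    ℝ :=
  fderiv ℝ (fun z => fderiv ℝ g z e) z e

lemma continuous_dirDeriv2 {E : Type*} [NormedAddCommGroup E] [NormedSpace ℝ E]
    {g : E → ℝ} (hg : ContDiff ℝ 2 g) (e : E) :
    Continuous (dirDeriv2 e g) :=
  continuous_fderiv_apply' (contDiff_fderiv_apply' hg e) e

lemma deriv_deriv_comp {E : Type*} [NormedAddCommGroup E] [NormedSpace ℝ E] {g : E → ℝ}
    (hg : ContDiff ℝ 2 g) {γ : ℝ → E} {e : E} (hγ : ∀ s, HasDerivAt γ e s) (s : ℝ) :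
    deriv (deriv fun s => g (γ s)) s = dirDeriv2 e g (γ s) := by
  have h1 : (deriv fun s => g (γ s)) = fun s => fderiv ℝ g (γ s) e := funext fun s =>
    ((hg.differentiable two_ne_zero (γ s)).hasFDerivAt.comp_hasDerivAt s (hγ s)).deriv
  rw [h1]
  exact (((contDiff_fderiv_apply' hg e).differentiable one_ne_zero
    (γ s)).hasFDerivAt.comp_hasDerivAt s (hγ s)).deriv

lemma integral_dirDeriv2_eq_zero {g : ℝ × ℝ → ℝ} (hg : ContDiff ℝ 2 g) (hp : UnitPeriodic g)
    (e : ℝ × ℝ) : ∫ z, dirDeriv2 e g z ∂unitSq = 0 :=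
  integral_fderiv_eq_zero (contDiff_fderiv_apply' hg e) (hp.fderiv_apply e) e

/-- Integration by parts on the torus. -/
lemma integral_pow_mul_dirDeriv2 {W F : ℝ × ℝ → ℝ} (hW : ContDiff ℝ 2 W) (hF : ContDiff ℝ 1 F)
    (pW : UnitPeriodic W) (pF : UnitPeriodic F) (e : ℝ × ℝ) (n : ℕ) :
    ∫ z, F z ^ (n + 1) * dirDeriv2 e W z ∂unitSq =
      -∫ z, (n + 1) * F z ^ n * (fderiv ℝ F z e * fderiv ℝ W z e) ∂unitSq := by
  have cW := contDiff_fderiv_apply' hW e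
  have cF := continuous_fderiv_apply' hF e
  have cF0 := hF.continuous
  have cW0 := cW.continuous
  have cW2 := continuous_dirDeriv2 hW e
  have hz := integral_fderiv_eq_zero (g := fun z => F z ^ (n + 1) * fderiv ℝ W z e)
    ((hF.pow _).mul cW) (fun s t => by
      have := pW.fderiv_apply e s t
      have := pF s t
      simp_all) e
  have e1 : ∀ z, fderiv ℝ (fun z => F z ^ (n + 1) * fderiv ℝ W z e) z e =
      F z ^ (n + 1) * dirDeriv2 e W z +
        (n + 1) * F z ^ n * (fderiv ℝ F z e * fderiv ℝ W z e) := by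
    intro z
    have d1 := (hF.differentiable one_ne_zero z).hasFDerivAt.pow (n + 1)
    have d2 := (cW.differentiable one_ne_zero z).hasFDerivAt
    have := (d1.mul d2).fderiv
    have h3 : fderiv ℝ (fun z => F z ^ (n + 1) * fderiv ℝ W z e) z = _ := this
    rw [h3]
    simp [dirDeriv2]
    ring
  simp only [e1] at hz
  rw [integral_add (integrable_unitSq (by fun_prop)) (integrable_unitSq (by fun_prop))] at hz
  linarith

/-- A periodic continuous function is bounded by its moments. -/
lemma sq_le_of_moments {F : ℝ × ℝ → ℝ} (hF : Continuous F) (hp : UnitPeriodic F) {B : ℝ}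
    (hB : ∀ k : ℕ, ∫ z, F z ^ (2 * 2 ^ k) ∂unitSq ≤ B ^ 2 ^ k) (z : ℝ × ℝ) : F z ^ 2 ≤ B := by
  have hB0 : 0 ≤ B := by
    have h1 := hB 0
    simp only [pow_zero, mul_one, pow_one] at h1
    exact (integral_nonneg fun z => sq_nonneg _).trans h1
  have h1 : ∀ z ∈ Set.Ioo (0:ℝ) 1 ×ˢ Set.Ioo (0:ℝ) 1, F z ^ 2 ≤ B := by
    intro z hz
    by_contra! hlt
    obtain ⟨B', hB', hB'z⟩ := exists_between hlt
    set O := {z | B' < F z ^ 2} ∩ Set.Ioo (0:ℝ) 1 ×ˢ Set.Ioo (0:ℝ) 1 with hO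
    have oO : IsOpen O := (isOpen_lt continuous_const (hF.pow 2)).inter (isOpen_Ioo.prod isOpen_Ioo)
    have pO : 0 < unitSq.real O := by
      rw [unitSq_eq, measureReal_restrict_apply oO.measurableSet]
      have : O ∩ Set.Ioc (0:ℝ) 1 ×ˢ Set.Ioc (0:ℝ) 1 = O := by
        rw [Set.inter_eq_left]
        exact Set.inter_subset_right.trans
          (Set.prod_mono Set.Ioo_subset_Ioc_self Set.Ioo_subset_Ioc_self)
      rw [this, measureReal_def]
      refine ENNReal.toReal_pos (oO.measure_pos _ ⟨z, hB'z, hz⟩).ne' ?_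
      refine ((measure_mono Set.inter_subset_right).trans_lt ?_).ne
      rw [Measure.volume_eq_prod, Measure.prod_prod]
      simp
    have hB'0 : 0 < B' := hB0.trans_lt hB'
    have hk : ∀ k : ℕ, unitSq.real O ≤ (B / B') ^ 2 ^ k := by
      intro k
      rw [div_pow, le_div_iff₀ (by positivity), mul_comm]
      refine le_trans ?_ (hB k)
      have hi : Integrable (fun z => F z ^ (2 * 2 ^ k)) unitSq := integrable_unitSq (hF.pow _)
      refine le_trans ?_ (mul_meas_ge_le_integral_of_nonneg
        (.of_forall fun z => by simpa using (even_two_mul _).pow_nonneg _) hi (B' ^ 2 ^ k))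
      refine mul_le_mul_of_nonneg_left (measureReal_mono fun w hw => ?_) (by positivity)
      simp only [Set.mem_ofPred_eq, pow_mul]
      exact pow_le_pow_left₀ hB'0.le hw.1.le _
    have lim : Filter.Tendsto (fun k : ℕ => (B / B') ^ 2 ^ k) Filter.atTop (nhds 0) :=
      (tendsto_pow_atTop_nhds_zero_of_lt_one (by positivity) ((div_lt_one hB'0).2 hB')).comp
        (Filter.tendsto_atTop_mono (fun k => Nat.lt_two_pow_self.le) Filter.tendsto_id)
    exact absurd (ge_of_tendsto' lim hk) (not_le.2 pO)
  have h2 : ∀ z ∈ Set.Icc (0:ℝ) 1 ×ˢ Set.Icc (0:ℝ) 1, F z ^ 2 ≤ B := by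
    have hcl : closure (Set.Ioo (0:ℝ) 1 ×ˢ Set.Ioo (0:ℝ) 1) =
        Set.Icc (0:ℝ) 1 ×ˢ Set.Icc (0:ℝ) 1 := by
      rw [closure_prod_eq, closure_Ioo zero_ne_one]
    rw [← hcl]
    exact fun z hz => (isClosed_le (hF.pow 2) continuous_const).closure_subset_iff.2 h1 hz
  have p1 : ∀ t, Function.Periodic (fun s => F (s, t)) 1 := fun t s => (hp s t).1
  have p2 : ∀ s, Function.Periodic (fun t => F (s, t)) 1 := fun s t => (hp s t).2
  have q1 := (p1 z.2).sub_zsmul_eq (x := z.1) ⌊z.1⌋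
  have q2 := (p2 (Int.fract z.1)).sub_zsmul_eq (x := z.2) ⌊z.2⌋
  simp only [zsmul_eq_mul, mul_one, Int.self_sub_floor] at q1 q2
  have := h2 (Int.fract z.1, Int.fract z.2)
    ⟨⟨Int.fract_nonneg _, (Int.fract_lt_one _).le⟩, ⟨Int.fract_nonneg _, (Int.fract_lt_one _).le⟩⟩
  rwa [q2, q1] at this

/-- A solution of the Toda equation, in coordinates adapted to the lattice: periods are `1`, and
the Laplacian is the sum of squares of the directional derivatives along `e` and `e'`. -/
structure TodaTorus (e e' : ℝ × ℝ) (V U1 U2 : ℝ → ℝ × ℝ → ℝ) : Prop where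
  smooth : ∀ ξ, ContDiff ℝ 2 (V ξ)
  per : ∀ ξ, UnitPeriodic (V ξ)
  cont1 : Continuous (Function.uncurry U1)
  cont2 : Continuous (Function.uncurry U2)
  contV : Continuous (Function.uncurry V)
  der1 : ∀ ξ z, HasDerivAt (fun ξ => exp (V ξ z)) (U1 ξ z) ξ
  der2 : ∀ ξ z, HasDerivAt (fun ξ => U1 ξ z) (U2 ξ z) ξ
  pde : ∀ ξ ≥ 0, ∀ z, U2 ξ z + dirDeriv2 e (V ξ) z + dirDeriv2 e' (V ξ) z = 0

namespace TodaTorus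

variable {e e' : ℝ × ℝ} {V U1 U2 : ℝ → ℝ × ℝ → ℝ}

lemma continuous_slice {h : ℝ → ℝ × ℝ → ℝ} (hc : Continuous (Function.uncurry h)) (ξ : ℝ) :
    Continuous (h ξ) :=
  hc.comp (by fun_prop : Continuous fun z : ℝ × ℝ => (ξ, z))

/-- The slice average of `exp V` is affine. -/
lemma mean_affine (H : TodaTorus e e' V U1 U2) {ξ : ℝ} (hξ : 0 ≤ ξ) :
    ∫ z, exp (V ξ z) ∂unitSq =
      ∫ z, exp (V 0 z) ∂unitSq + (∫ z, U1 0 z ∂unitSq) * ξ := by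
  have d1 := hasDerivAt_integral_unitSq H.der1
    (fun ξ => Real.continuous_exp.comp (H.smooth ξ).continuous) H.cont1
  have d2 := hasDerivAt_integral_unitSq H.der2 (continuous_slice H.cont1) H.cont2
  have z2 : ∀ ξ ≥ 0, ∫ z, U2 ξ z ∂unitSq = 0 := by
    intro ξ hξ
    have : ∀ z, U2 ξ z = -(dirDeriv2 e (V ξ) z + dirDeriv2 e' (V ξ) z) := fun z => by
      linarith [H.pde ξ hξ z]
    simp only [this]
    rw [integral_neg, integral_add (integrable_unitSq (continuous_dirDeriv2 (H.smooth ξ) e))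
      (integrable_unitSq (continuous_dirDeriv2 (H.smooth ξ) e')),
      integral_dirDeriv2_eq_zero (H.smooth ξ) (H.per ξ),
      integral_dirDeriv2_eq_zero (H.smooth ξ) (H.per ξ)]
    simp
  have c1 : ∀ x ≥ 0, ∫ z, U1 x z ∂unitSq = ∫ z, U1 0 z ∂unitSq := fun x hx =>
    constant_of_has_deriv_right_zero (a := 0) (b := x)
      (fun y _ => (d2 y).continuousAt.continuousWithinAt)
      (fun y hy => by rw [← z2 y hy.1]; exact (d2 y).hasDerivWithinAt) x ⟨hx, le_rfl⟩
  have d3 : ∀ y, HasDerivAt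
      (fun y => ∫ z, exp (V y z) ∂unitSq - (∫ z, U1 0 z ∂unitSq) * y)
      (∫ z, U1 y z ∂unitSq - (∫ z, U1 0 z ∂unitSq) * 1) y := fun y =>
    (d1 y).sub ((hasDerivAt_id y).const_mul _)
  have := constant_of_has_deriv_right_zero (a := 0) (b := ξ)
    (fun y _ => (d3 y).continuousAt.continuousWithinAt)
    (fun y hy => by
      have := (d3 y).hasDerivWithinAt (s := Set.Ici y)
      rwa [c1 y hy.1, mul_one, sub_self] at this) ξ ⟨hξ, le_rfl⟩
  simp only [mul_zero, sub_zero] at this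
  linarith

/-- The deviation of `exp V` from an affine function of `ξ`. -/
def dev (V : ℝ → ℝ × ℝ → ℝ) (A a ξ : ℝ) (z : ℝ × ℝ) : ℝ := exp (V ξ z) - (A + a * ξ)

/-- Even moments of the deviation. -/
def moment (V : ℝ → ℝ × ℝ → ℝ) (A a : ℝ) (n : ℕ) (ξ : ℝ) : ℝ :=
  ∫ z, dev V A a ξ z ^ (2 * n + 2) ∂unitSq

/-- The first derivative of `moment` in `ξ`. -/
def momentDeriv (V U1 : ℝ → ℝ × ℝ → ℝ) (A a : ℝ) (n : ℕ) (ξ : ℝ) : ℝ :=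
  ∫ z, (2 * n + 2) * dev V A a ξ z ^ (2 * n + 1) * (U1 ξ z - a) ∂unitSq

/-- The second derivative of `moment` in `ξ`. -/
def momentDeriv2 (V U1 U2 : ℝ → ℝ × ℝ → ℝ) (A a : ℝ) (n : ℕ) (ξ : ℝ) : ℝ :=
  ∫ z, ((2 * n + 2) * (2 * n + 1) * dev V A a ξ z ^ (2 * n) * (U1 ξ z - a) ^ 2 +
    (2 * n + 2) * (dev V A a ξ z ^ (2 * n + 1) * U2 ξ z)) ∂unitSq

lemma contDiff_dev (H : TodaTorus e e' V U1 U2) (A a ξ : ℝ) : ContDiff ℝ 2 (dev V A a ξ) :=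
  (H.smooth ξ).exp.sub contDiff_const

lemma per_dev (H : TodaTorus e e' V U1 U2) (A a ξ : ℝ) : UnitPeriodic (dev V A a ξ) := by
  intro s t
  simp [dev, (H.per ξ s t).1, (H.per ξ s t).2]

lemma continuous_dev (H : TodaTorus e e' V U1 U2) (A a : ℝ) :
    Continuous (Function.uncurry (dev V A a)) := by
  have : Continuous fun p : ℝ × ℝ × ℝ => V p.1 p.2 := H.contV
  simp only [Function.uncurry_def, dev]
  fun_prop

lemma hasDerivAt_dev (H : TodaTorus e e' V U1 U2) (A a ξ : ℝ) (z : ℝ × ℝ) :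
    HasDerivAt (fun ξ => dev V A a ξ z) (U1 ξ z - a) ξ := by
  have := (H.der1 ξ z).fun_sub (((hasDerivAt_id ξ).const_mul a).const_add A)
  rw [mul_one] at this
  exact this

lemma hasDerivAt_moment (H : TodaTorus e e' V U1 U2) (A a : ℝ) (n : ℕ) (ξ : ℝ) :
    HasDerivAt (moment V A a n) (momentDeriv V U1 A a n ξ) ξ := by
  refine hasDerivAt_integral_unitSq (h := fun ξ z => dev V A a ξ z ^ (2 * n + 2))
    (h' := fun ξ z => (2 * n + 2) * dev V A a ξ z ^ (2 * n + 1) * (U1 ξ z - a)) (fun ξ z => ?_)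
    (fun ξ => (H.contDiff_dev A a ξ).continuous.pow _) ?_ ξ
  · simpa using (H.hasDerivAt_dev A a ξ z).fun_pow (2 * n + 2)
  · have h1 := H.continuous_dev A a
    have h2 := H.cont1
    simp only [Function.uncurry_def] at h1 h2 ⊢
    fun_prop

lemma hasDerivAt_momentDeriv (H : TodaTorus e e' V U1 U2) (A a : ℝ) (n : ℕ) (ξ : ℝ) :
    HasDerivAt (momentDeriv V U1 A a n) (momentDeriv2 V U1 U2 A a n ξ) ξ := by
  have h1 := H.continuous_dev A a
  have h2 := H.cont1
  have h3 := H.cont2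
  refine hasDerivAt_integral_unitSq
    (h := fun ξ z => (2 * n + 2) * dev V A a ξ z ^ (2 * n + 1) * (U1 ξ z - a))
    (h' := fun ξ z => (2 * n + 2) * (2 * n + 1) * dev V A a ξ z ^ (2 * n) * (U1 ξ z - a) ^ 2 +
      (2 * n + 2) * (dev V A a ξ z ^ (2 * n + 1) * U2 ξ z))
    (fun ξ z => ?_) (fun ξ => ?_) ?_ ξ
  · have := (((H.hasDerivAt_dev A a ξ z).fun_pow (2 * n + 1)).const_mul (2 * n + 2 : ℝ)).fun_mul
      ((H.der2 ξ z).sub_const a)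
    refine this.congr_deriv ?_
    push_cast
    ring
  · have h1 := continuous_slice h1 ξ
    have h2 := continuous_slice h2 ξ
    fun_prop
  · simp only [Function.uncurry_def] at h1 h2 h3 ⊢
    fun_prop

lemma fderiv_dev (H : TodaTorus e e' V U1 U2) (A a ξ : ℝ) (z w : ℝ × ℝ) :
    fderiv ℝ (dev V A a ξ) z w = exp (V ξ z) * fderiv ℝ (V ξ) z w := by
  have h1 : HasFDerivAt (V ξ) (fderiv ℝ (V ξ) z) z :=
    ((H.smooth ξ).differentiable two_ne_zero z).hasFDerivAt
  have h2 : HasFDerivAt (dev V A a ξ) _ z := h1.exp.sub_const (A + a * ξ)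
  rw [h2.fderiv]
  simp

/-- The energy inequality: the second derivative of an even moment controls the Dirichlet
energy of a power of the deviation. -/
lemma dirichlet_le_momentDeriv2 (H : TodaTorus e e' V U1 U2) {K Umax : ℝ} (hK : 0 < K)
    (hell : ∀ p q : ℝ,
      p ^ 2 + q ^ 2 ≤ K * ((e.1 * p + e.2 * q) ^ 2 + (e'.1 * p + e'.2 * q) ^ 2))
    (A a : ℝ) (n : ℕ) {ξ : ℝ} (hξ : 0 ≤ ξ) (hU : ∀ z, exp (V ξ z) ≤ Umax) :
    2 * dirichlet (fun z => dev V A a ξ z ^ (n + 1)) ≤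
      K * Umax * momentDeriv2 V U1 U2 A a n ξ := by
  have hF := H.contDiff_dev A a ξ
  have pF := H.per_dev A a ξ
  have hFD : ∀ z w, fderiv ℝ (dev V A a ξ) z w = exp (V ξ z) * fderiv ℝ (V ξ) z w :=
    H.fderiv_dev A a ξ
  have cU1 := continuous_slice H.cont1 ξ
  have cU2 := continuous_slice H.cont2 ξ
  have hUm : 0 < Umax := (exp_pos _).trans_le (hU 0)
  have pde := H.pde ξ hξ
  have hW := H.smooth ξ
  have pW := H.per ξ
  rw [momentDeriv2]
  set F := dev V A a ξ with hFdef
  set W := V ξ with hWdef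
  have cF := hF.continuous
  have cW := hW.continuous
  have hF1 : ContDiff ℝ 1 F := hF.of_le (by norm_num)
  have hW1 : ContDiff ℝ 1 W := hW.of_le (by norm_num)
  have cFD := continuous_fderiv_apply' hF1
  have cWD := continuous_fderiv_apply' hW1
  have c2 := continuous_dirDeriv2 hW
  have ibp := fun e => integral_pow_mul_dirDeriv2 hW hF1 pW pF e (2 * n)
  have e1 : ∫ z, F z ^ (2 * n + 1) * U2 ξ z ∂unitSq =
      ∫ z, (2 * n + 1) * F z ^ (2 * n) *
        (fderiv ℝ F z e * fderiv ℝ W z e + fderiv ℝ F z e' * fderiv ℝ W z e') ∂unitSq := by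
    have h1 : ∀ z, F z ^ (2 * n + 1) * U2 ξ z = -(F z ^ (2 * n + 1) * dirDeriv2 e W z +
        F z ^ (2 * n + 1) * dirDeriv2 e' W z) := fun z => by
      linear_combination F z ^ (2 * n + 1) * pde z
    simp only [h1, mul_add ((2 * n + 1 : ℝ) * _)]
    rw [integral_neg, integral_add (integrable_unitSq (by fun_prop)) (integrable_unitSq (by fun_prop)),
      integral_add (integrable_unitSq (by fun_prop)) (integrable_unitSq (by fun_prop)), ibp e, ibp e']
    push_cast
    ring
  rw [integral_add (integrable_unitSq (by fun_prop)) (integrable_unitSq (by fun_prop)),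
    integral_const_mul (2 * n + 2 : ℝ), e1, ← integral_const_mul (2 * n + 2 : ℝ),
    ← integral_add (integrable_unitSq (by fun_prop)) (integrable_unitSq (by fun_prop)),
    ← integral_const_mul, dirichlet, ← integral_const_mul]
  have dpow : ∀ z w, fderiv ℝ (fun z => F z ^ (n + 1)) z w = (n + 1) * F z ^ n * fderiv ℝ F z w := by
    intro z w
    have h1 : HasFDerivAt (fun z => F z ^ (n + 1)) _ z :=
      (hF1.differentiable one_ne_zero z).hasFDerivAt.pow (n + 1)
    rw [h1.fderiv]
    simp
  simp only [dpow]
  refine integral_mono (integrable_unitSq (by fun_prop)) (integrable_unitSq (by fun_prop)) fun z => ?_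
  have ell := hell (fderiv ℝ F z (1, 0)) (fderiv ℝ F z (0, 1))
  rw [← fderiv_apply_eq, ← fderiv_apply_eq, hFD z e, hFD z e'] at ell
  dsimp only
  rw [hFD z e, hFD z e']
  set p := fderiv ℝ W z e
  set q := fderiv ℝ W z e'
  set s := fderiv ℝ F z (1, 0)
  set t := fderiv ℝ F z (0, 1)
  set u := exp (W z)
  have hu0 : 0 < u := exp_pos _
  have hF2 : F z ^ (2 * n) = (F z ^ n) ^ 2 := by rw [mul_comm, pow_mul]
  rw [hF2]
  have hn : (0:ℝ) ≤ n := n.cast_nonneg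
  set Y := u * p * p + u * q * q with hY
  have hY0 : 0 ≤ Y := by rw [hY]; nlinarith [mul_nonneg hu0.le (sq_nonneg p), mul_nonneg hu0.le (sq_nonneg q)]
  have h1 : s ^ 2 + t ^ 2 ≤ K * Umax * Y := by
    calc s ^ 2 + t ^ 2 ≤ K * ((u * p) ^ 2 + (u * q) ^ 2) := ell
      _ = K * u * Y := by rw [hY]; ring
      _ ≤ K * Umax * Y := by gcongr; exact hU z
  set m := F z ^ n
  have h2 : 0 ≤ K * Umax * ((2 * n + 2) * (2 * n + 1) * m ^ 2 * (U1 ξ z - a) ^ 2) := by positivity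
  have h3 : 2 * (n + 1 : ℝ) ^ 2 * m ^ 2 * (s ^ 2 + t ^ 2) ≤
      2 * (n + 1 : ℝ) ^ 2 * m ^ 2 * (K * Umax * Y) := by gcongr
  have h4 : 2 * (n + 1 : ℝ) ^ 2 * (m ^ 2 * (K * Umax * Y)) ≤
      (2 * n + 2) * (2 * n + 1) * (m ^ 2 * (K * Umax * Y)) :=
    mul_le_mul_of_nonneg_right (by nlinarith) (by positivity)
  nlinarith

lemma integral_dev_eq_zero (H : TodaTorus e e' V U1 U2) {ξ : ℝ} (hξ : 0 ≤ ξ) :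
    ∫ z, dev V (∫ z, exp (V 0 z) ∂unitSq) (∫ z, U1 0 z ∂unitSq) ξ z ∂unitSq = 0 := by
  simp only [dev]
  rw [integral_sub (integrable_unitSq (H.smooth ξ).continuous.rexp) (integrable_const _),
    H.mean_affine hξ]
  simp

lemma moment_nonneg (V : ℝ → ℝ × ℝ → ℝ) (A a : ℝ) (n : ℕ) (ξ : ℝ) : 0 ≤ moment V A a n ξ :=
  integral_nonneg fun _ => ((even_two_mul n).add even_two).pow_nonneg _

lemma momentDeriv2_nonneg (H : TodaTorus e e' V U1 U2) {K : ℝ} (hK : 0 < K)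
    (hell : ∀ p q : ℝ,
      p ^ 2 + q ^ 2 ≤ K * ((e.1 * p + e.2 * q) ^ 2 + (e'.1 * p + e'.2 * q) ^ 2))
    {B : ℝ} (hB : 0 < B) (hU : ∀ ξ ≥ 0, ∀ z, exp (V ξ z) ≤ B * (1 + ξ))
    (A a : ℝ) (n : ℕ) {ξ : ℝ} (hξ : 0 ≤ ξ) : 0 ≤ momentDeriv2 V U1 U2 A a n ξ := by
  have h1 := H.dirichlet_le_momentDeriv2 hK hell A a n hξ (hU ξ hξ)
  have h2 : 0 ≤ dirichlet (fun z => dev V A a ξ z ^ (n + 1)) :=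
    integral_nonneg fun _ => by positivity
  exact nonneg_of_mul_nonneg_right ((by positivity : (0:ℝ) ≤ _).trans h1) (by positivity)

/-- Stretched exponential decay of the variance of `exp V` on slices. -/
lemma moment_zero_le (H : TodaTorus e e' V U1 U2) {K : ℝ} (hK : 0 < K)
    (hell : ∀ p q : ℝ,
      p ^ 2 + q ^ 2 ≤ K * ((e.1 * p + e.2 * q) ^ 2 + (e'.1 * p + e'.2 * q) ^ 2))
    {B : ℝ} (hB : 0 < B) (hU : ∀ ξ ≥ 0, ∀ z, exp (V ξ z) ≤ B * (1 + ξ)) {A a : ℝ}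
    (hdev : ∀ ξ ≥ 0, ∀ z, |dev V A a ξ z| ≤ B * (1 + ξ))
    (hmean : ∀ ξ ≥ 0, ∫ z, dev V A a ξ z ∂unitSq = 0)
    {δ : ℝ} (hδ : 0 < δ) (hδ1 : δ ≤ 1) (hδK : δ ≤ (K * B)⁻¹) {ξ : ℝ} (hξ : 0 ≤ ξ) :
    moment V A a 0 ξ ≤ moment V A a 0 0 * exp δ * exp (-δ * √(1 + ξ)) := by
  refine decay_of_deriv2_ge (B := B ^ 2) (H.hasDerivAt_moment A a 0)
    (H.hasDerivAt_momentDeriv A a 0) hδ hδ1 hδK (fun x hx => ?_) (moment_nonneg _ _ _ _ _)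
    (fun x hx => ?_) hξ
  · have h1 := H.dirichlet_le_momentDeriv2 hK hell A a 0 hx (hU x hx)
    have h2 := poincare_unitSq ((H.contDiff_dev A a x).of_le (by norm_num)) (hmean x hx)
    have h3 : moment V A a 0 x = ∫ z, dev V A a x z ^ 2 ∂unitSq := by simp [moment]
    simp only [zero_add, pow_one] at h1
    rw [← h3] at h2
    have h4 := h2.trans h1
    have hx1 : 0 < 1 + x := by linarith
    calc (K * B)⁻¹ / (1 + x) * moment V A a 0 x
        ≤ (K * B)⁻¹ / (1 + x) * (K * (B * (1 + x)) * momentDeriv2 V U1 U2 A a 0 x) := by gcongr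
      _ = momentDeriv2 V U1 U2 A a 0 x := by field_simp
  · have h1 : moment V A a 0 x ≤ ∫ _, (B * (1 + x)) ^ 2 ∂unitSq := by
      refine integral_mono (integrable_unitSq ((H.contDiff_dev A a x).continuous.pow _))
        (integrable_const _) fun z => ?_
      simp only [mul_zero, zero_add]
      exact sq_le_sq' (neg_le_of_abs_le (hdev x hx z)) (le_of_abs_le (hdev x hx z))
    refine h1.trans_eq ?_
    simp [mul_pow]

/-- Local boundedness: the deviation is controlled by its variance on nearby slices. -/
lemma sq_dev_le (H : TodaTorus e e' V U1 U2) {K : ℝ} (hK : 0 < K)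
    (hell : ∀ p q : ℝ,
      p ^ 2 + q ^ 2 ≤ K * ((e.1 * p + e.2 * q) ^ 2 + (e'.1 * p + e'.2 * q) ^ 2))
    {B : ℝ} (hB : 0 < B) (hU : ∀ ξ ≥ 0, ∀ z, exp (V ξ z) ≤ B * (1 + ξ)) {A a c S : ℝ}
    (hc : 2 ≤ c) (hS : ∀ x ∈ Set.Icc (c - 2) (c + 2), moment V A a 0 x ≤ S) (z : ℝ × ℝ) :
    dev V A a c z ^ 2 ≤ 16 * (33 * (2 + K * (B * (3 + c)))) ^ 2 * S := by
  have hk : ∀ k : ℕ, 2 ^ k - 1 + 1 = 2 ^ k := fun k => Nat.sub_add_cancel Nat.one_le_two_pow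
  have hk2 : ∀ k : ℕ, 2 * (2 ^ k - 1) + 2 = 2 * 2 ^ k := fun k => by rw [← hk k]; simp; ring
  have hpos : ∀ x ∈ Set.Icc (c - 2) (c + 2), 0 ≤ x := fun x hx => by linarith [hx.1]
  have h2 : ∀ k : ℕ, ∀ x ∈ Set.Icc (c - 2) (c + 2),
      0 ≤ momentDeriv2 V U1 U2 A a (2 ^ k - 1) x := fun k x hx =>
    H.momentDeriv2_nonneg hK hell hB hU A a _ (hpos x hx)
  have hKB : 0 < K * (B * (3 + c)) := by positivity
  refine sq_le_of_moments (H.contDiff_dev A a c).continuous (H.per_dev A a c) (fun k => ?_) z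
  have key := moser_iteration (G := fun k => moment V A a (2 ^ k - 1))
    (R := 2 + K * (B * (3 + c))) (S := S)
    (fun k => H.hasDerivAt_moment A a _) (fun k => H.hasDerivAt_momentDeriv A a _) (by linarith)
    (fun k x => moment_nonneg _ _ _ _ _) h2 (fun k x hx => ?_) (by simpa using hS) k
  · simpa only [moment, hk2] using key
  · have e1 : ∀ z, exp (V x z) ≤ B * (3 + c) := fun z =>
      (hU x (hpos x hx) z).trans (mul_le_mul_of_nonneg_left (by linarith [hx.2]) hB.le)
    have h3 := H.dirichlet_le_momentDeriv2 hK hell A a (2 ^ k - 1) (hpos x hx) e1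
    have h4 := sobolev_unitSq (g := fun z => dev V A a x z ^ 2 ^ k)
      (((H.contDiff_dev A a x).of_le (by norm_num)).pow _)
    rw [hk] at h3
    have e4 : ∫ z, (dev V A a x z ^ 2 ^ k) ^ 4 ∂unitSq = moment V A a (2 ^ (k + 1) - 1) x := by
      simp only [moment, hk2, ← pow_mul]
      congr! 3
      ring
    have e2 : ∫ z, (dev V A a x z ^ 2 ^ k) ^ 2 ∂unitSq = moment V A a (2 ^ k - 1) x := by
      simp only [moment, hk2, ← pow_mul]
      congr! 3
      ring
    have m0 := moment_nonneg V A a (2 ^ k - 1) x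
    have d0 : 0 ≤ dirichlet (fun z => dev V A a x z ^ 2 ^ k) :=
      integral_nonneg fun _ => by positivity
    rw [e4, e2] at h4
    refine h4.trans (pow_le_pow_left₀ (by linarith) ?_ 2)
    have := mul_nonneg hKB.le m0
    have := h2 k x hx
    nlinarith

lemma abs_log_sub_log_le {m x y : ℝ} (hm : 0 < m) (hx : m ≤ x) (hy : m ≤ y) :
    |log x - log y| ≤ |x - y| / m := by
  have key : ∀ {x y : ℝ}, m ≤ x → m ≤ y → log x - log y ≤ |x - y| / m := by
    intro x y hx hy
    have hx0 := hm.trans_le hx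
    have hy0 := hm.trans_le hy
    rw [← Real.log_div hx0.ne' hy0.ne']
    calc log (x / y) ≤ x / y - 1 := Real.log_le_sub_one_of_pos (by positivity)
      _ = (x - y) / y := by field_simp
      _ ≤ |x - y| / y := by gcongr; exact le_abs_self _
      _ ≤ |x - y| / m := by gcongr
  refine abs_le'.2 ⟨key hx hy, ?_⟩
  rw [neg_sub, abs_sub_comm]
  exact key hy hx

/-- A polynomial prefactor is absorbed by halving the rate of a stretched exponential. -/
lemma abs_le_exp_of_sq_le {δ c P S : ℝ} (hδ : 0 < δ) (hc : 2 ≤ c) (hP : 0 ≤ P) (hS : 0 ≤ S)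
    {f : ℝ} (hf : f ^ 2 ≤ 16 * (33 * (2 + P * (3 + c))) ^ 2 * (S * exp (-δ * √(c - 1)))) :
    |f| ≤ 132 * (2 + P) * (4 + 32 / δ ^ 2) * √S * exp (δ / 4) * exp (-(δ / 4) * √c) := by
  set w := √(c - 1) with hw
  have hw0 : 0 ≤ w := Real.sqrt_nonneg _
  have hw2 : w ^ 2 = c - 1 := Real.sq_sqrt (by linarith)
  have hcw : √c ≤ w + 1 := by
    rw [Real.sqrt_le_left (by linarith)]
    nlinarith
  have h1 : 3 + c ≤ (4 + 32 / δ ^ 2) * exp (δ / 4 * w) := by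
    have hx : 0 ≤ δ / 4 * w := by positivity
    have hq := Real.quadratic_le_exp_of_nonneg hx
    have e1 : w ^ 2 = 32 / δ ^ 2 * ((δ / 4 * w) ^ 2 / 2) := by field_simp; ring
    have e2 : 32 / δ ^ 2 * ((δ / 4 * w) ^ 2 / 2) ≤ 32 / δ ^ 2 * exp (δ / 4 * w) := by
      gcongr
      linarith
    nlinarith
  have h2 : 2 + P * (3 + c) ≤ (2 + P) * (4 + 32 / δ ^ 2) * exp (δ / 4 * w) := by
    rw [mul_assoc]
    exact le_trans (by nlinarith) (mul_le_mul_of_nonneg_left h1 (by positivity))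
  have h3 : |f| ≤ 132 * ((2 + P) * (4 + 32 / δ ^ 2) * exp (δ / 4 * w)) *
      (√S * exp (-(δ / 2) * w)) := by
    refine abs_le_of_sq_le_sq (hf.trans ?_) (by positivity)
    have e1 : S * exp (-δ * w) = (√S * exp (-(δ / 2) * w)) ^ 2 := by
      rw [mul_pow, Real.sq_sqrt hS, ← Real.exp_nat_mul]
      congr 2
      push_cast
      ring
    rw [e1, mul_pow, mul_pow _ (√S * _) 2, mul_pow 132]
    have : (2 + P * (3 + c)) ^ 2 ≤ ((2 + P) * (4 + 32 / δ ^ 2) * exp (δ / 4 * w)) ^ 2 :=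
      pow_le_pow_left₀ (by nlinarith) h2 2
    refine mul_le_mul_of_nonneg_right ?_ (by positivity)
    linarith
  have h4 : exp (δ / 4 * w) * exp (-(δ / 2) * w) ≤ exp (δ / 4) * exp (-(δ / 4) * √c) := by
    rw [← Real.exp_add, ← Real.exp_add, Real.exp_le_exp]
    nlinarith
  calc |f| ≤ _ := h3
    _ = 132 * (2 + P) * (4 + 32 / δ ^ 2) * √S * (exp (δ / 4 * w) * exp (-(δ / 2) * w)) := by ring
    _ ≤ 132 * (2 + P) * (4 + 32 / δ ^ 2) * √S * (exp (δ / 4) * exp (-(δ / 4) * √c)) := by gcongr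
    _ = _ := by ring

/-- Model asymptotics for solutions of the Toda equation on the torus. -/
theorem asymptotics (H : TodaTorus e e' V U1 U2) {K : ℝ} (hK : 0 < K)
    (hell : ∀ p q : ℝ,
      p ^ 2 + q ^ 2 ≤ K * ((e.1 * p + e.2 * q) ^ 2 + (e'.1 * p + e'.2 * q) ^ 2))
    {M : ℝ} (hM : ∀ ξ ≥ (0:ℝ), ∀ z, |V ξ z - log (1 + ξ)| ≤ M) :
    ∃ a > (0:ℝ), ∃ C > (0:ℝ), ∃ δ > (0:ℝ), ∀ ξ ≥ (0:ℝ), ∀ z,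
      |V ξ z - log (∫ z, exp (V 0 z) ∂unitSq + a * ξ)| ≤ C * exp (-δ * √ξ) := by
  have hM0 : 0 ≤ M := (abs_nonneg _).trans (hM 0 le_rfl 0)
  have up : ∀ ξ ≥ 0, ∀ z, exp (V ξ z) ≤ exp M * (1 + ξ) := by
    intro ξ hξ z
    have h1 : 0 < 1 + ξ := by linarith
    calc exp (V ξ z) ≤ exp (M + log (1 + ξ)) := by
          gcongr
          linarith [(abs_le.1 (hM ξ hξ z)).2]
      _ = _ := by rw [Real.exp_add, Real.exp_log h1]
  have lo : ∀ ξ ≥ 0, ∀ z, exp (-M) * (1 + ξ) ≤ exp (V ξ z) := by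
    intro ξ hξ z
    have h1 : 0 < 1 + ξ := by linarith
    calc exp (-M) * (1 + ξ) = exp (-M + log (1 + ξ)) := by rw [Real.exp_add, Real.exp_log h1]
      _ ≤ _ := by
          gcongr
          linarith [(abs_le.1 (hM ξ hξ z)).1]
  set A := ∫ z, exp (V 0 z) ∂unitSq with hA
  set a := ∫ z, U1 0 z ∂unitSq with ha
  have ci : ∀ ξ, Integrable (fun z => exp (V ξ z)) unitSq := fun ξ =>
    integrable_unitSq (H.smooth ξ).continuous.rexp
  have upm : ∀ ξ ≥ 0, A + a * ξ ≤ exp M * (1 + ξ) := by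
    intro ξ hξ
    rw [hA, ha, ← H.mean_affine hξ]
    exact (integral_mono (ci ξ) (integrable_const _) (up ξ hξ)).trans_eq (by simp)
  have lom : ∀ ξ ≥ 0, exp (-M) * (1 + ξ) ≤ A + a * ξ := by
    intro ξ hξ
    rw [hA, ha, ← H.mean_affine hξ]
    exact (integral_mono (integrable_const _) (ci ξ) (lo ξ hξ)).trans_eq' (by simp)
  have hM1 : 0 < exp (-M) := exp_pos _
  have apos : 0 < a := by
    by_contra! hle
    have hA0 : 0 < A := by nlinarith [lom 0 le_rfl]
    have h1 := lom (A / exp (-M)) (by positivity)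
    have h2 : exp (-M) * (1 + A / exp (-M)) = exp (-M) + A := by field_simp
    have h3 : a * (A / exp (-M)) ≤ 0 := mul_nonpos_of_nonpos_of_nonneg hle (by positivity)
    linarith
  have hdev : ∀ ξ ≥ 0, ∀ z, |dev V A a ξ z| ≤ exp M * (1 + ξ) := by
    intro ξ hξ z
    have h0 : 0 ≤ exp (-M) * (1 + ξ) := by positivity
    rw [abs_le, dev]
    constructor <;> linarith [up ξ hξ z, lo ξ hξ z, upm ξ hξ, lom ξ hξ]
  set δ := min 1 (K * exp M)⁻¹ with hδd
  have hδ : 0 < δ := by positivity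
  set S := moment V A a 0 0 * exp δ with hSd
  have hS0 : 0 ≤ S := mul_nonneg (moment_nonneg _ _ _ _ _) (exp_pos _).le
  have decay : ∀ ξ ≥ 0, moment V A a 0 ξ ≤ S * exp (-δ * √(1 + ξ)) := fun ξ hξ =>
    H.moment_zero_le hK hell (exp_pos M) up hdev (fun ξ hξ => H.integral_dev_eq_zero hξ)
      hδ (min_le_left _ _) (min_le_right _ _) hξ
  set D := 132 * (2 + K * exp M) * (4 + 32 / δ ^ 2) * √S * exp (δ / 4) with hD
  have hD0 : 0 ≤ D := by positivity
  refine ⟨a, apos, D / exp (-M) + (2 * M + 1) * exp (δ / 2), by positivity, δ / 4, by positivity,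
    fun ξ hξ z => ?_⟩
  have x1 := lo ξ hξ z
  have x2 := lom ξ hξ
  have pos1 : exp (-M) ≤ exp (-M) * (1 + ξ) := by nlinarith
  have l1 := abs_log_sub_log_le hM1 (pos1.trans x1) (pos1.trans x2)
  rw [Real.log_exp] at l1
  rcases le_total 2 ξ with h | h
  · have hsq := H.sq_dev_le (A := A) (a := a) (S := S * exp (-δ * √(ξ - 1))) hK hell (exp_pos M) up
      h (fun x hx => ?_) z
    · rw [← mul_assoc K] at hsq
      have := abs_le_exp_of_sq_le hδ h (by positivity) hS0 hsq
      rw [← hD] at this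
      refine l1.trans ?_
      rw [add_mul, div_mul_eq_mul_div]
      refine (div_le_div_of_nonneg_right this hM1.le).trans (le_add_of_nonneg_right ?_)
      positivity
    · have hx0 : 0 ≤ x := by linarith [hx.1]
      refine (decay x hx0).trans (mul_le_mul_of_nonneg_left ?_ hS0)
      have : √(ξ - 1) ≤ √(1 + x) := Real.sqrt_le_sqrt (by linarith [hx.1])
      rw [Real.exp_le_exp]
      nlinarith
  · have t1 : |V ξ z - log (A + a * ξ)| ≤ 2 * M := by
      have hx1 : 0 < 1 + ξ := by linarith
      have h2 := Real.log_le_log (by positivity) x2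
      have h3 := Real.log_le_log (by nlinarith) (upm ξ hξ)
      rw [Real.log_mul (exp_pos _).ne' hx1.ne', Real.log_exp] at h2 h3
      have h4 := abs_le.1 (hM ξ hξ z)
      rw [abs_le]
      constructor <;> linarith
    have hs : √ξ ≤ 2 := by
      rw [Real.sqrt_le_left (by norm_num)]
      linarith
    have t2 : 1 ≤ exp (δ / 2) * exp (-(δ / 4) * √ξ) := by
      rw [← Real.exp_add, Real.one_le_exp_iff]
      nlinarith
    have t3 : 0 ≤ D / exp (-M) * exp (-(δ / 4) * √ξ) := by positivity
    nlinarith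

end TodaTorus

end Toda

section Transfer

lemma mul_self_det {v1 v2 : ℝ × ℝ} (hdet : |v1.1 * v2.2 - v1.2 * v2.1| = 1) :
    (v1.1 * v2.2 - v1.2 * v2.1) * (v1.1 * v2.2 - v1.2 * v2.1) = 1 := by
  rw [← abs_mul_abs_self, hdet, one_mul]

/-- A solution of the Toda equation, written in lattice coordinates. -/
lemma todaTorus_of_isSolBVP2 {v1 v2 : ℝ × ℝ} (hdet : |v1.1 * v2.2 - v1.2 * v2.1| = 1)
    {φ : ℝ → ℝ → ℝ} {v : ℝ → ℝ → ℝ → ℝ} (hv : IsSolBVP2 v1 v2 φ v) :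
    TodaTorus
      ((v1.1 * v2.2 - v1.2 * v2.1) * v2.2, -((v1.1 * v2.2 - v1.2 * v2.1) * v1.2))
      (-((v1.1 * v2.2 - v1.2 * v2.1) * v2.1), (v1.1 * v2.2 - v1.2 * v2.1) * v1.1)
      (fun ξ z => v ξ (z.1 * v1.1 + z.2 * v2.1) (z.1 * v1.2 + z.2 * v2.2))
      (fun ξ z => fderiv ℝ (fun p : ℝ × ℝ × ℝ => exp (v p.1 p.2.1 p.2.2))
        (ξ, z.1 * v1.1 + z.2 * v2.1, z.1 * v1.2 + z.2 * v2.2) (1, 0, 0))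
      (fun ξ z => dirDeriv2 (1, 0, 0) (fun p : ℝ × ℝ × ℝ => exp (v p.1 p.2.1 p.2.2))
        (ξ, z.1 * v1.1 + z.2 * v2.1, z.1 * v1.2 + z.2 * v2.2)) := by
  obtain ⟨hs, -, hper, -, hpde⟩ := hv
  have hD := mul_self_det hdet
  set D := v1.1 * v2.2 - v1.2 * v2.1 with hDd
  have hE : ContDiff ℝ 2 fun p : ℝ × ℝ × ℝ => exp (v p.1 p.2.1 p.2.2) := hs.exp
  set E : ℝ × ℝ × ℝ → ℝ := fun p => exp (v p.1 p.2.1 p.2.2) with hEd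
  have hsm : ∀ ξ, ContDiff ℝ 2
      fun z : ℝ × ℝ => v ξ (z.1 * v1.1 + z.2 * v2.1) (z.1 * v1.2 + z.2 * v2.2) := fun ξ =>
    hs.comp (by fun_prop : ContDiff ℝ 2 fun z : ℝ × ℝ =>
      (ξ, z.1 * v1.1 + z.2 * v2.1, z.1 * v1.2 + z.2 * v2.2))
  have cT : Continuous fun p : ℝ × ℝ × ℝ =>
      (p.1, p.2.1 * v1.1 + p.2.2 * v2.1, p.2.1 * v1.2 + p.2.2 * v2.2) := by fun_prop
  have curve : ∀ (x y s : ℝ), HasDerivAt (fun s : ℝ => (s, x, y)) ((1:ℝ), (0:ℝ), (0:ℝ)) s :=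
    fun x y s => (hasDerivAt_id s).prodMk ((hasDerivAt_const s x).prodMk (hasDerivAt_const s y))
  have dir : ∀ (e z : ℝ × ℝ) (s : ℝ), HasDerivAt (fun s : ℝ => z + s • e) e s := fun e z s => by
    simpa using ((hasDerivAt_id s).smul_const e).const_add z
  refine ⟨hsm, fun ξ s t => ?_, ?_, (continuous_dirDeriv2 hE _).comp cT, hs.continuous.comp cT,
    fun ξ z => ?_, fun ξ z => ?_, fun ξ hξ z => ?_⟩
  · have h := hper ξ (s * v1.1 + t * v2.1) (s * v1.2 + t * v2.2)
    constructor
    · rw [← h.1]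
      congr 1 <;> ring
    · rw [← h.2]
      congr 1 <;> ring
  · exact (continuous_fderiv_apply' (hE.of_le (by norm_num)) _).comp cT
  · exact (hE.differentiable two_ne_zero _).hasFDerivAt.comp_hasDerivAt ξ (curve _ _ ξ)
  · exact ((contDiff_fderiv_apply' hE _).differentiable one_ne_zero _).hasFDerivAt.comp_hasDerivAt
      ξ (curve _ _ ξ)
  · have h := hpde ξ hξ (z.1 * v1.1 + z.2 * v2.1) (z.1 * v1.2 + z.2 * v2.2)
    rw [todaOp] at h
    have t1 := deriv_deriv_comp hE (curve (z.1 * v1.1 + z.2 * v2.1) (z.1 * v1.2 + z.2 * v2.2)) ξ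
    have t2 := deriv_deriv_comp (hsm ξ) (dir (D * v2.2, -(D * v1.2)) z) 0
    have t3 := deriv_deriv_comp (hsm ξ) (dir (-(D * v2.1), D * v1.1) z) 0
    have e2 : (fun s : ℝ => v ξ
        ((z + s • (D * v2.2, -(D * v1.2))).1 * v1.1 + (z + s • (D * v2.2, -(D * v1.2))).2 * v2.1)
        ((z + s • (D * v2.2, -(D * v1.2))).1 * v1.2 + (z + s • (D * v2.2, -(D * v1.2))).2 * v2.2)) =
        fun s => (fun x' => v ξ x' (z.1 * v1.2 + z.2 * v2.2)) (s + (z.1 * v1.1 + z.2 * v2.1)) := by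
      funext s
      simp only [Prod.fst_add, Prod.snd_add, Prod.smul_fst, Prod.smul_snd, smul_eq_mul]
      congr 1
      · linear_combination s * hD
      · ring
    have e3 : (fun s : ℝ => v ξ
        ((z + s • (-(D * v2.1), D * v1.1)).1 * v1.1 + (z + s • (-(D * v2.1), D * v1.1)).2 * v2.1)
        ((z + s • (-(D * v2.1), D * v1.1)).1 * v1.2 + (z + s • (-(D * v2.1), D * v1.1)).2 * v2.2)) =
        fun s => (fun y' => v ξ (z.1 * v1.1 + z.2 * v2.1) y') (s + (z.1 * v1.2 + z.2 * v2.2)) := by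
      funext s
      simp only [Prod.fst_add, Prod.snd_add, Prod.smul_fst, Prod.smul_snd, smul_eq_mul]
      congr 1
      · ring
      · linear_combination s * hD
    have shift : ∀ (f : ℝ → ℝ) (c : ℝ),
        deriv (deriv fun s => f (s + c)) 0 = deriv (deriv f) c := by
      intro f c
      rw [funext fun s => deriv_comp_add_const f c s, deriv_comp_add_const, zero_add]
    rw [e2, shift fun x' => v ξ x' (z.1 * v1.2 + z.2 * v2.2)] at t2
    rw [e3, shift fun y' => v ξ (z.1 * v1.1 + z.2 * v2.1) y'] at t3
    simp only [zero_smul, add_zero] at t2 t3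
    rw [t1, t2, t3] at h
    exact h

/-- Ellipticity of the Laplacian in lattice coordinates. -/
lemma sq_add_sq_le_lattice {v1 v2 : ℝ × ℝ} (hdet : |v1.1 * v2.2 - v1.2 * v2.1| = 1) (p q : ℝ) :
    p ^ 2 + q ^ 2 ≤ (v1.1 ^ 2 + v1.2 ^ 2 + v2.1 ^ 2 + v2.2 ^ 2) *
      (((v1.1 * v2.2 - v1.2 * v2.1) * v2.2 * p + -((v1.1 * v2.2 - v1.2 * v2.1) * v1.2) * q) ^ 2 +
        (-((v1.1 * v2.2 - v1.2 * v2.1) * v2.1) * p +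
          (v1.1 * v2.2 - v1.2 * v2.1) * v1.1 * q) ^ 2) := by
  have hD := mul_self_det hdet
  set D := v1.1 * v2.2 - v1.2 * v2.1 with hDd
  set P := D * v2.2 * p + -(D * v1.2) * q with hP
  set R := -(D * v2.1) * p + D * v1.1 * q with hR
  have hp : p = v1.1 * P + v1.2 * R := by
    rw [hP, hR]
    linear_combination -p * hD + D * p * hDd
  have hq : q = v2.1 * P + v2.2 * R := by
    rw [hP, hR]
    linear_combination -q * hD + D * q * hDd
  rw [hp, hq]
  nlinarith [sq_nonneg (v1.1 * R - v1.2 * P), sq_nonneg (v2.1 * R - v2.2 * P)]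

end Transfer

/-- Model asymptotics for BVP2: `v` converges to `log(e^{φ̄} + aξ)` at rate `e^{−δ√ξ}`. -/
theorem stmt8
    (v1 v2 : ℝ × ℝ) (hdet : |v1.1 * v2.2 - v1.2 * v2.1| = 1)
    (φ : ℝ → ℝ → ℝ)
    (hφreg : ContDiff ℝ (⊤ : ℕ∞) (fun p : ℝ × ℝ => φ p.1 p.2))
    (hφper : LatticePeriodic v1 v2 φ)
    (v : ℝ → ℝ → ℝ → ℝ) (hv : IsSolBVP2 v1 v2 φ v) :
    ∃ a > (0:ℝ), ∃ C > (0:ℝ), ∃ δ > (0:ℝ), ∀ ξ ≥ (0:ℝ), ∀ x y : ℝ,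
      |v ξ x y -
          Real.log (Real.exp (Real.log (sliceAvg v1 v2 (fun x' y' => Real.exp (φ x' y')))) +
            a * ξ)| ≤
        C * Real.exp (-δ * Real.sqrt ξ) := by
  have H := todaTorus_of_isSolBVP2 hdet hv
  obtain ⟨-, ⟨M, hM⟩, -, h0, -⟩ := hv
  have hD := mul_self_det hdet
  have hK : 0 < v1.1 ^ 2 + v1.2 ^ 2 + v2.1 ^ 2 + v2.2 ^ 2 := by
    nlinarith [sq_nonneg (v1.1 - v2.2), sq_nonneg (v1.1 + v2.2), sq_nonneg (v1.2 - v2.1),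
      sq_nonneg (v1.2 + v2.1)]
  obtain ⟨a, ha, C, hC, δ, hδ, h⟩ := H.asymptotics hK (sq_add_sq_le_lattice hdet)
    (fun ξ hξ z => hM ξ hξ _ _)
  refine ⟨a, ha, C, hC, δ, hδ, fun ξ hξ x y => ?_⟩
  have c0 := (H.smooth 0).continuous.rexp
  have e0 : sliceAvg v1 v2 (fun x' y' => exp (φ x' y')) =
      ∫ z : ℝ × ℝ, exp (v 0 (z.1 * v1.1 + z.2 * v2.1) (z.1 * v1.2 + z.2 * v2.2)) ∂unitSq := by
    rw [integral_unitSq c0]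
    simp only [sliceAvg, h0]
  have pos : 0 < ∫ z : ℝ × ℝ,
      exp (v 0 (z.1 * v1.1 + z.2 * v2.1) (z.1 * v1.2 + z.2 * v2.2)) ∂unitSq :=
    integral_exp_pos (integrable_unitSq c0)
  rw [e0, Real.exp_log pos]
  set D := v1.1 * v2.2 - v1.2 * v2.1 with hDd
  have hz := h ξ hξ (D * (v2.2 * x - v2.1 * y), D * (v1.1 * y - v1.2 * x))
  have ex : D * (v2.2 * x - v2.1 * y) * v1.1 + D * (v1.1 * y - v1.2 * x) * v2.1 = x := by
    linear_combination x * hD - D * x * hDd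
  have ey : D * (v2.2 * x - v2.1 * y) * v1.2 + D * (v1.1 * y - v1.2 * x) * v2.2 = y := by
    linear_combination y * hD - D * y * hDd
  simpa only [ex, ey] using hz
end
end

section
/- Let Λ ⊂ ℝ² be a lattice of covolume 1, let φ : ℝ² → ℝ be a smooth Λ-periodic function, and let v : [0,∞) × ℝ² → ℝ be a twice continuously differentiable, Λ-periodic solution of the Toda equation (e^v)_{ξξ} + v_{xx} + v_{yy} = 0 with v(0,·) = φ such that v − log(1+ξ) is bounded. Then W := 1 − (1/2)·ξ·v_ξ(ξ,x,y) > 0 for all ξ ≥ 0 and all (x,y) ∈ ℝ². -/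
open Real MeasureTheory

noncomputable section

namespace Toda

open Set Filter Topology

/-- Points `(ξ, x, y)`. -/
abbrev Pt : Type := ℝ × ℝ × ℝ

/-- The directional derivative of `f` along `e`. -/
def dir (f : Pt → ℝ) (e : Pt) (p : Pt) : ℝ := fderiv ℝ f p e

/-- The coordinate direction `ξ`. -/
abbrev e₀ : Pt := (1, 0, 0)

/-- The coordinate direction `x`. -/
abbrev e₁ : Pt := (0, 1, 0)

/-- The coordinate direction `y`. -/
abbrev e₂ : Pt := (0, 0, 1)

theorem continuous_dir {f : Pt → ℝ} (hf : ContDiff ℝ 1 f) (e : Pt) : Continuous (dir f e) :=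
  (hf.continuous_fderiv (by simp)).clm_apply continuous_const

theorem contDiff_dir {f : Pt → ℝ} (hf : ContDiff ℝ 2 f) (e : Pt) : ContDiff ℝ 1 (dir f e) :=
  (hf.fderiv_right (m := 1) (by norm_num)).clm_apply contDiff_const

theorem dir_sub {f g : Pt → ℝ} (hf : ContDiff ℝ 1 f) (hg : ContDiff ℝ 1 g) (e : Pt) :
    dir (fun p => f p - g p) e = fun p => dir f e p - dir g e p := by
  funext p
  have h := ((hf.differentiable (by simp)) p).hasFDerivAt.sub
    ((hg.differentiable (by simp)) p).hasFDerivAt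
  exact congrArg (fun L : Pt →L[ℝ] ℝ => L e) h.fderiv

theorem dir_mul {f g : Pt → ℝ} (hf : ContDiff ℝ 1 f) (hg : ContDiff ℝ 1 g) (e p : Pt) :
    dir (fun p => f p * g p) e p = f p * dir g e p + g p * dir f e p := by
  have h := ((hf.differentiable (by simp)) p).hasFDerivAt.mul
    ((hg.differentiable (by simp)) p).hasFDerivAt
  exact congrArg (fun L : Pt →L[ℝ] ℝ => L e) h.fderiv

theorem dir_comp {P : ℝ → ℝ} {f : Pt → ℝ} (hP : ContDiff ℝ 1 P) (hf : ContDiff ℝ 1 f)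
    (e p : Pt) : dir (fun p => P (f p)) e p = deriv P (f p) * dir f e p := by
  have h := ((hP.differentiable (by simp)) (f p)).hasDerivAt.comp_hasFDerivAt p
    ((hf.differentiable (by simp)) p).hasFDerivAt
  exact congrArg (fun L : Pt →L[ℝ] ℝ => L e) h.fderiv

theorem dir_exp {f : Pt → ℝ} (hf : ContDiff ℝ 1 f) (e p : Pt) :
    dir (fun p => exp (f p)) e p = exp (f p) * dir f e p := by
  simpa using dir_comp contDiff_exp hf e p

theorem hasDerivAt_comp_line {f : Pt → ℝ} (hf : ContDiff ℝ 1 f) {γ : ℝ → Pt} {e : Pt} {t : ℝ}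
    (hγ : HasDerivAt γ e t) : HasDerivAt (fun s => f (γ s)) (dir f e (γ t)) t :=
  ((hf.differentiable (by simp)) (γ t)).hasFDerivAt.comp_hasDerivAt t hγ

/-- The point of the slice at height `ξ` with lattice coordinates `q`. -/
def place (v1 v2 : ℝ × ℝ) (ξ : ℝ) (q : ℝ × ℝ) : Pt :=
  (ξ, q.1 * v1.1 + q.2 * v2.1, q.1 * v1.2 + q.2 * v2.2)

theorem continuous_place (v1 v2 : ℝ × ℝ) :
    Continuous (fun r : ℝ × ℝ × ℝ => place v1 v2 r.1 r.2) := by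
  unfold place; fun_prop

theorem continuous_place_right (v1 v2 : ℝ × ℝ) (ξ : ℝ) : Continuous (place v1 v2 ξ) := by
  unfold place; fun_prop

theorem hasDerivAt_place_height (v1 v2 : ℝ × ℝ) (ξ : ℝ) (q : ℝ × ℝ) :
    HasDerivAt (fun s => place v1 v2 s q) e₀ ξ :=
  (hasDerivAt_id ξ).prodMk (hasDerivAt_const ξ _)

theorem hasDerivAt_place_fst (v1 v2 : ℝ × ℝ) (ξ s t : ℝ) :
    HasDerivAt (fun s => place v1 v2 ξ (s, t)) (0, v1) s := by
  refine (hasDerivAt_const s _).prodMk (HasDerivAt.prodMk (f₁' := v1.1) (f₂' := v1.2) ?_ ?_)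
  · simpa using ((hasDerivAt_id s).mul_const v1.1).add_const (t * v2.1)
  · simpa using ((hasDerivAt_id s).mul_const v1.2).add_const (t * v2.2)

theorem hasDerivAt_place_snd (v1 v2 : ℝ × ℝ) (ξ s t : ℝ) :
    HasDerivAt (fun t => place v1 v2 ξ (s, t)) (0, v2) t := by
  refine (hasDerivAt_const t _).prodMk (HasDerivAt.prodMk (f₁' := v2.1) (f₂' := v2.2) ?_ ?_)
  · simpa using ((hasDerivAt_id t).mul_const v2.1).const_add (s * v1.1)
  · simpa using ((hasDerivAt_id t).mul_const v2.2).const_add (s * v1.2)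

/-- Lebesgue measure on the unit interval. -/
def unitMeasure : Measure ℝ := volume.restrict (Icc 0 1)

/-- Lebesgue measure on the unit square. -/
def squareMeasure : Measure (ℝ × ℝ) := unitMeasure.prod unitMeasure

instance : IsProbabilityMeasure unitMeasure := ⟨by simp [unitMeasure]⟩

instance : IsProbabilityMeasure squareMeasure := by unfold squareMeasure; infer_instance

theorem squareMeasure_eq : squareMeasure = volume.restrict (Icc 0 1 ×ˢ Icc 0 1) := by
  rw [squareMeasure, unitMeasure, Measure.prod_restrict]; rfl

theorem ae_mem_square : ∀ᵐ q ∂squareMeasure, q ∈ Icc (0 : ℝ) 1 ×ˢ Icc (0 : ℝ) 1 := by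
  rw [squareMeasure_eq]
  exact ae_restrict_mem (measurableSet_Icc.prod measurableSet_Icc)

theorem integrable_unitMeasure {f : ℝ → ℝ} (hf : Continuous f) : Integrable f unitMeasure :=
  hf.continuousOn.integrableOn_compact isCompact_Icc

theorem integrable_squareMeasure {f : ℝ × ℝ → ℝ} (hf : Continuous f) :
    Integrable f squareMeasure := by
  rw [squareMeasure_eq]
  exact hf.continuousOn.integrableOn_compact (isCompact_Icc.prod isCompact_Icc)

theorem integral_unitMeasure (f : ℝ → ℝ) : ∫ t, f t ∂unitMeasure = ∫ t in (0 : ℝ)..1, f t := by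
  rw [unitMeasure, integral_Icc_eq_integral_Ioc, intervalIntegral.integral_of_le zero_le_one]

/-- The integral of `f` over the period cell of the slice at height `ξ`. -/
def cellInt (v1 v2 : ℝ × ℝ) (f : Pt → ℝ) (ξ : ℝ) : ℝ :=
  ∫ q, f (place v1 v2 ξ q) ∂squareMeasure

theorem integrable_cell (v1 v2 : ℝ × ℝ) {f : Pt → ℝ} (hf : Continuous f) (ξ : ℝ) :
    Integrable (fun q => f (place v1 v2 ξ q)) squareMeasure :=
  integrable_squareMeasure (hf.comp (continuous_place_right v1 v2 ξ))

theorem cellInt_mono (v1 v2 : ℝ × ℝ) {f g : Pt → ℝ} (hf : Continuous f) (hg : Continuous g)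
    {ξ : ℝ} (h : ∀ p : Pt, p.1 = ξ → f p ≤ g p) : cellInt v1 v2 f ξ ≤ cellInt v1 v2 g ξ :=
  integral_mono (integrable_cell v1 v2 hf ξ) (integrable_cell v1 v2 hg ξ) fun _ => h _ rfl

theorem cellInt_mono_of_mem (v1 v2 : ℝ × ℝ) {f g : Pt → ℝ} (hf : Continuous f)
    (hg : Continuous g) {ξ : ℝ}
    (h : ∀ q ∈ Icc (0 : ℝ) 1 ×ˢ Icc (0 : ℝ) 1, f (place v1 v2 ξ q) ≤ g (place v1 v2 ξ q)) :
    cellInt v1 v2 f ξ ≤ cellInt v1 v2 g ξ :=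
  integral_mono_ae (integrable_cell v1 v2 hf ξ) (integrable_cell v1 v2 hg ξ)
    (ae_mem_square.mono h)

theorem cellInt_const (v1 v2 : ℝ × ℝ) (c ξ : ℝ) : cellInt v1 v2 (fun _ => c) ξ = c := by
  simp [cellInt]

theorem cellInt_add (v1 v2 : ℝ × ℝ) {f g : Pt → ℝ} (hf : Continuous f) (hg : Continuous g)
    (ξ : ℝ) :
    cellInt v1 v2 (fun p => f p + g p) ξ = cellInt v1 v2 f ξ + cellInt v1 v2 g ξ :=
  integral_add (integrable_cell v1 v2 hf ξ) (integrable_cell v1 v2 hg ξ)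

theorem cellInt_const_mul (v1 v2 : ℝ × ℝ) (f : Pt → ℝ) (c ξ : ℝ) :
    cellInt v1 v2 (fun p => c * f p) ξ = c * cellInt v1 v2 f ξ :=
  integral_const_mul _ _

theorem cellInt_nonneg (v1 v2 : ℝ × ℝ) {f : Pt → ℝ} {ξ : ℝ} (h : ∀ p : Pt, p.1 = ξ → 0 ≤ f p) :
    0 ≤ cellInt v1 v2 f ξ :=
  integral_nonneg fun _ => h _ rfl

/-- A continuous function is bounded on the part of the cylinder over the period cell with
height in a compact interval. -/
theorem exists_bound_cell (v1 v2 : ℝ × ℝ) {f : Pt → ℝ} (hf : Continuous f) (a b : ℝ) :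
    ∃ C, 0 ≤ C ∧ ∀ ξ ∈ Icc a b, ∀ q ∈ Icc (0 : ℝ) 1 ×ˢ Icc (0 : ℝ) 1,
      |f (place v1 v2 ξ q)| ≤ C := by
  have hK : IsCompact (Icc a b ×ˢ (Icc (0 : ℝ) 1 ×ˢ Icc (0 : ℝ) 1)) :=
    isCompact_Icc.prod (isCompact_Icc.prod isCompact_Icc)
  obtain ⟨C, hC⟩ := hK.exists_bound_of_continuousOn
    (hf.comp (continuous_place v1 v2)).continuousOn
  refine ⟨|C|, abs_nonneg C, fun ξ hξ q hq => ?_⟩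
  exact (hC (ξ, q) ⟨hξ, hq⟩).trans (le_abs_self C)

theorem hasDerivAt_cellInt (v1 v2 : ℝ × ℝ) {f : Pt → ℝ} (hf : ContDiff ℝ 1 f) (ξ : ℝ) :
    HasDerivAt (cellInt v1 v2 f) (cellInt v1 v2 (dir f e₀) ξ) ξ := by
  obtain ⟨C, -, hC⟩ := exists_bound_cell v1 v2 (continuous_dir hf e₀) (ξ - 1) (ξ + 1)
  refine (hasDerivAt_integral_of_dominated_loc_of_deriv_le
    (F' := fun x q => dir f e₀ (place v1 v2 x q)) (bound := fun _ => C)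
    (Icc_mem_nhds (by linarith) (by linarith) : Icc (ξ - 1) (ξ + 1) ∈ 𝓝 ξ)
    (Eventually.of_forall fun x => (integrable_cell v1 v2 hf.continuous x).1)
    (integrable_cell v1 v2 hf.continuous ξ)
    (integrable_cell v1 v2 (continuous_dir hf e₀) ξ).1
    (ae_mem_square.mono fun q hq x hx => hC x hx q hq) (integrable_const C)
    (Eventually.of_forall fun q x _ =>
      hasDerivAt_comp_line hf (hasDerivAt_place_height v1 v2 x q))).2

/-- Invariance under the lattice translations in the `(x, y)`-variables. -/
def Periodic (v1 v2 : ℝ × ℝ) (f : Pt → ℝ) : Prop :=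
  ∀ p, f (p + (0, v1)) = f p ∧ f (p + (0, v2)) = f p

theorem Periodic.dir {v1 v2 : ℝ × ℝ} {f : Pt → ℝ} (h : Periodic v1 v2 f) (e : Pt) :
    Periodic v1 v2 (dir f e) := by
  have key : ∀ a : Pt, (∀ p, f (p + a) = f p) → ∀ p, Toda.dir f e (p + a) = Toda.dir f e p := by
    intro a ha p
    have := fderiv_comp_add_right (𝕜 := ℝ) (f := f) (x := p) a
    rw [funext ha] at this
    simp [Toda.dir, this]
  exact fun p => ⟨key _ (fun p => (h p).1) p, key _ (fun p => (h p).2) p⟩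

theorem cellInt_dir_lattice {v1 v2 : ℝ × ℝ} {f : Pt → ℝ} (hf : ContDiff ℝ 1 f)
    (hper : Periodic v1 v2 f) (ξ : ℝ) :
    cellInt v1 v2 (dir f (0, v1)) ξ = 0 ∧ cellInt v1 v2 (dir f (0, v2)) ξ = 0 := by
  have hc : ∀ e, Continuous fun q => dir f e (place v1 v2 ξ q) := fun e =>
    (continuous_dir hf e).comp (continuous_place_right v1 v2 ξ)
  constructor
  · rw [cellInt, squareMeasure, integral_prod_symm _ (integrable_squareMeasure (hc _))]
    refine (integral_congr_ae (Eventually.of_forall fun t => ?_)).trans (integral_zero _ _)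
    rw [integral_unitMeasure, intervalIntegral.integral_eq_sub_of_hasDerivAt
      (fun s _ => hasDerivAt_comp_line hf (hasDerivAt_place_fst v1 v2 ξ s t))
      (((hc _).comp (by fun_prop : Continuous fun s : ℝ => (s, t))).intervalIntegrable 0 1),
      ← (hper (place v1 v2 ξ (0, t))).1, sub_eq_zero]
    congr 1
    ext <;> simp [place, add_comm]
  · rw [cellInt, squareMeasure, integral_prod _ (integrable_squareMeasure (hc _))]
    refine (integral_congr_ae (Eventually.of_forall fun s => ?_)).trans (integral_zero _ _)
    rw [integral_unitMeasure, intervalIntegral.integral_eq_sub_of_hasDerivAt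
      (fun t _ => hasDerivAt_comp_line hf (hasDerivAt_place_snd v1 v2 ξ s t))
      (((hc _).comp (by fun_prop : Continuous fun t : ℝ => (s, t))).intervalIntegrable 0 1),
      ← (hper (place v1 v2 ξ (s, 0))).2, sub_eq_zero]
    congr 1
    ext <;> simp [place]

theorem dir_lattice (f : Pt → ℝ) (a : ℝ × ℝ) (p : Pt) :
    dir f (0, a) p = a.1 * dir f e₁ p + a.2 * dir f e₂ p := by
  have : ((0, a) : Pt) = a.1 • e₁ + a.2 • e₂ := by ext <;> simp
  rw [dir, this, map_add, map_smul, map_smul]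
  rfl

theorem cellInt_dir_eq_zero {v1 v2 : ℝ × ℝ} (hdet : v1.1 * v2.2 - v1.2 * v2.1 ≠ 0)
    {f : Pt → ℝ} (hf : ContDiff ℝ 1 f) (hper : Periodic v1 v2 f) (ξ : ℝ) :
    cellInt v1 v2 (dir f e₁) ξ = 0 ∧ cellInt v1 v2 (dir f e₂) ξ = 0 := by
  obtain ⟨h1, h2⟩ := cellInt_dir_lattice hf hper ξ
  have expand : ∀ a : ℝ × ℝ, cellInt v1 v2 (dir f (0, a)) ξ =
      a.1 * cellInt v1 v2 (dir f e₁) ξ + a.2 * cellInt v1 v2 (dir f e₂) ξ := by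
    intro a
    rw [← cellInt_const_mul, ← cellInt_const_mul, ← cellInt_add v1 v2
      ((continuous_dir hf e₁).const_mul a.1) ((continuous_dir hf e₂).const_mul a.2)]
    exact congrArg (fun F => cellInt v1 v2 F ξ) (funext fun p => dir_lattice f a p)
  rw [expand] at h1 h2
  constructor
  · refine (mul_eq_zero.1 (?_ : (v1.1 * v2.2 - v1.2 * v2.1) * _ = 0)).resolve_left hdet
    linear_combination v2.2 * h1 - v1.2 * h2
  · refine (mul_eq_zero.1 (?_ : (v1.1 * v2.2 - v1.2 * v2.1) * _ = 0)).resolve_left hdet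
    linear_combination v1.1 * h2 - v2.1 * h1

/-- For `u_{ξξ} + g_{xx} + g_{yy} = 0`, the first two derivatives of the slice integrals of
`P(u)`, after an integration by parts. -/
theorem hasDerivAt_cellInt_comp {v1 v2 : ℝ × ℝ} (hdet : v1.1 * v2.2 - v1.2 * v2.1 ≠ 0)
    {u g : Pt → ℝ} (hu : ContDiff ℝ 2 u) (hg : ContDiff ℝ 2 g) (pu : Periodic v1 v2 u)
    (pg : Periodic v1 v2 g)
    (heq : ∀ p : Pt, 0 ≤ p.1 →
      dir (dir u e₀) e₀ p + dir (dir g e₁) e₁ p + dir (dir g e₂) e₂ p = 0)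
    {P : ℝ → ℝ} (hP : ContDiff ℝ 2 P) :
    (∀ ξ, HasDerivAt (cellInt v1 v2 fun p => P (u p))
      (cellInt v1 v2 (fun p => deriv P (u p) * dir u e₀ p) ξ) ξ) ∧
    ∀ ξ, 0 ≤ ξ → HasDerivAt (cellInt v1 v2 fun p => deriv P (u p) * dir u e₀ p)
      (cellInt v1 v2 (fun p => deriv (deriv P) (u p) *
        (dir u e₀ p ^ 2 + dir u e₁ p * dir g e₁ p + dir u e₂ p * dir g e₂ p)) ξ) ξ := by
  have hu1 : ContDiff ℝ 1 u := hu.of_le (by norm_num)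
  have hP1 : ContDiff ℝ 1 P := hP.of_le (by norm_num)
  have hdP : ContDiff ℝ 1 (deriv P) := (contDiff_succ_iff_deriv.1 hP).2.2
  have hQ : ContDiff ℝ 1 fun p => deriv P (u p) := hdP.comp hu1
  have hprod : ∀ f : Pt → ℝ, ContDiff ℝ 2 f → ∀ e p,
      dir (fun p => deriv P (u p) * dir f e p) e p =
        deriv P (u p) * dir (dir f e) e p +
          deriv (deriv P) (u p) * (dir u e p * dir f e p) := by
    intro f hf e p
    rw [dir_mul hQ (contDiff_dir hf e), dir_comp hdP hu1]
    ring
  refine ⟨fun ξ => ?_, fun ξ hξ => ?_⟩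
  · simp only [← dir_comp hP1 hu1]
    exact hasDerivAt_cellInt v1 v2 (hP1.comp hu1) ξ
  · have hF : ∀ f : Pt → ℝ, ContDiff ℝ 2 f → ∀ e,
        ContDiff ℝ 1 fun p => deriv P (u p) * dir f e p :=
      fun f hf e => hQ.mul (contDiff_dir hf e)
    have pF : ∀ e, Periodic v1 v2 fun p => deriv P (u p) * dir g e p := by
      intro e p
      simp only [(pu p).1, (pu p).2, ((pg.dir e) p).1, ((pg.dir e) p).2, and_self]
    have z1 := (cellInt_dir_eq_zero hdet (hF g hg e₁) (pF e₁) ξ).1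
    have z2 := (cellInt_dir_eq_zero hdet (hF g hg e₂) (pF e₂) ξ).2
    have hD := hasDerivAt_cellInt v1 v2 (hF u hu e₀) ξ
    have k0 := continuous_dir (hF u hu e₀) e₀
    have k1 := continuous_dir (hF g hg e₁) e₁
    have k2 := continuous_dir (hF g hg e₂) e₂
    have hval : cellInt v1 v2 (dir (fun p => deriv P (u p) * dir u e₀ p) e₀) ξ =
        cellInt v1 v2 (fun p => dir (fun p => deriv P (u p) * dir u e₀ p) e₀ p +
          dir (fun p => deriv P (u p) * dir g e₁ p) e₁ p +
          dir (fun p => deriv P (u p) * dir g e₂ p) e₂ p) ξ := by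
      rw [cellInt_add v1 v2 (f := fun p => dir (fun p => deriv P (u p) * dir u e₀ p) e₀ p +
        dir (fun p => deriv P (u p) * dir g e₁ p) e₁ p) (k0.add k1) k2,
        cellInt_add v1 v2 k0 k1, z1, z2, add_zero, add_zero]
    rw [hval] at hD
    convert hD using 1
    refine integral_congr_ae (Eventually.of_forall fun q => ?_)
    simp only [hprod u hu, hprod g hg]
    linear_combination -(deriv P (u (place v1 v2 ξ q))) * heq (place v1 v2 ξ q) hξ

theorem abs_sub_le_integral_unit {h h' : ℝ → ℝ} (hd : ∀ x, HasDerivAt h (h' x) x)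
    (hc : Continuous h') {s s' : ℝ} (hs : s ∈ Icc (0 : ℝ) 1) (hs' : s' ∈ Icc (0 : ℝ) 1) :
    |h s - h s'| ≤ ∫ r, |h' r| ∂unitMeasure := by
  rw [← intervalIntegral.integral_eq_sub_of_hasDerivAt (fun x _ => hd x)
    (hc.intervalIntegrable s' s), ← Real.norm_eq_abs]
  refine intervalIntegral.norm_integral_le_integral_norm_uIoc.trans ?_
  refine setIntegral_mono_set (integrable_unitMeasure hc.abs)
    (Eventually.of_forall fun r => abs_nonneg _) (LE.le.eventuallyLE ?_)
  exact uIoc_subset_uIcc.trans (uIcc_subset_Icc hs' hs)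

/-- The Poincaré inequality in `L¹` on the period cell. -/
theorem cellInt_abs_sub_mean_le (v1 v2 : ℝ × ℝ) {f : Pt → ℝ} (hf : ContDiff ℝ 1 f) (ξ : ℝ) :
    cellInt v1 v2 (fun p => |f p - cellInt v1 v2 f ξ|) ξ ≤
      cellInt v1 v2 (fun p => |dir f (0, v1) p|) ξ +
        cellInt v1 v2 (fun p => |dir f (0, v2) p|) ξ := by
  set F : ℝ × ℝ → ℝ := fun q => f (place v1 v2 ξ q) with hF
  have cF : Continuous F := hf.continuous.comp (continuous_place_right v1 v2 ξ)
  have cd : ∀ e, Continuous fun q => dir f e (place v1 v2 ξ q) := fun e =>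
    (continuous_dir hf e).comp (continuous_place_right v1 v2 ξ)
  set A : ℝ × ℝ → ℝ := fun q => |dir f (0, v1) (place v1 v2 ξ q)| with hA
  set B : ℝ × ℝ → ℝ := fun q => |dir f (0, v2) (place v1 v2 ξ q)| with hB
  have iA : Integrable A (unitMeasure.prod unitMeasure) := integrable_squareMeasure (cd _).abs
  have iB : Integrable B (unitMeasure.prod unitMeasure) := integrable_squareMeasure (cd _).abs
  set a : ℝ → ℝ := fun t => ∫ r, A (r, t) ∂unitMeasure
  set b : ℝ → ℝ := fun s => ∫ r, B (s, r) ∂unitMeasure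
  have ia : Integrable a unitMeasure := iA.integral_prod_right
  have ib : Integrable b unitMeasure := iB.integral_prod_left
  have ia' : Integrable (fun q : ℝ × ℝ => a q.2) squareMeasure := ia.comp_snd unitMeasure
  have ib' : Integrable (fun q : ℝ × ℝ => b q.1) squareMeasure := ib.comp_fst unitMeasure
  have Ia : ∫ q : ℝ × ℝ, a q.2 ∂squareMeasure = ∫ q, A q ∂squareMeasure := by
    rw [squareMeasure, integral_fun_snd, integral_prod_symm A iA]
    simp [a]
  have Ib : ∫ q : ℝ × ℝ, b q.1 ∂squareMeasure = ∫ q, B q ∂squareMeasure := by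
    rw [squareMeasure, integral_fun_fst, integral_prod B iB]
    simp [b]
  have hdiff : ∀ q ∈ Icc (0 : ℝ) 1 ×ˢ Icc (0 : ℝ) 1, ∀ q' ∈ Icc (0 : ℝ) 1 ×ˢ Icc (0 : ℝ) 1,
      |F q - F q'| ≤ a q.2 + b q'.1 := by
    rintro ⟨s, t⟩ ⟨hs, ht⟩ ⟨s', t'⟩ ⟨hs', ht'⟩
    have h1 := abs_sub_le_integral_unit (h := fun s => F (s, t))
      (fun r => hasDerivAt_comp_line hf (hasDerivAt_place_fst v1 v2 ξ r t))
      ((cd _).comp (by fun_prop : Continuous fun r : ℝ => (r, t))) hs hs'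
    have h2 := abs_sub_le_integral_unit (h := fun t => F (s', t))
      (fun r => hasDerivAt_comp_line hf (hasDerivAt_place_snd v1 v2 ξ s' r))
      ((cd _).comp (by fun_prop : Continuous fun r : ℝ => (s', r))) ht ht'
    exact (abs_sub_le _ (F (s', t)) _).trans (add_le_add h1 h2)
  have hmean : ∀ q ∈ Icc (0 : ℝ) 1 ×ˢ Icc (0 : ℝ) 1,
      |F q - cellInt v1 v2 f ξ| ≤ a q.2 + ∫ q, B q ∂squareMeasure := by
    intro q hq
    have h1 : F q - cellInt v1 v2 f ξ = ∫ q', (F q - F q') ∂squareMeasure := by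
      rw [integral_sub (integrable_const _) (integrable_squareMeasure cF)]
      simp [cellInt, hF]
    have h2 : ∫ q' : ℝ × ℝ, (a q.2 + b q'.1) ∂squareMeasure =
        a q.2 + ∫ q, B q ∂squareMeasure := by
      rw [integral_add (integrable_const _) ib', Ib]
      simp
    rw [h1, ← h2]
    refine abs_integral_le_integral_abs.trans (integral_mono_ae
      (integrable_squareMeasure (continuous_const.sub cF).abs) ((integrable_const _).add ib')
      (ae_mem_square.mono fun q' hq' => hdiff q hq q' hq'))
  have h3 : ∫ q : ℝ × ℝ, (a q.2 + ∫ q, B q ∂squareMeasure) ∂squareMeasure =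
      ∫ q, A q ∂squareMeasure + ∫ q, B q ∂squareMeasure := by
    rw [integral_add ia' (integrable_const _), Ia]
    simp
  refine le_trans ?_ h3.le
  exact integral_mono_ae (integrable_squareMeasure (cF.sub continuous_const).abs)
    (ia'.add (integrable_const _)) (ae_mem_square.mono hmean)

theorem taylor_lower_bound {J J' J'' : ℝ → ℝ} {a b c : ℝ} (hab : a ≤ b)
    (h1 : ∀ x ∈ Icc a b, HasDerivAt J (J' x) x) (h2 : ∀ x ∈ Icc a b, HasDerivAt J' (J'' x) x)
    (hc : ∀ x ∈ Icc a b, c ≤ J'' x) :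
    J a + J' a * (b - a) + c / 2 * (b - a) ^ 2 ≤ J b := by
  have key : ∀ {f f' g g' : ℝ → ℝ}, (∀ x ∈ Icc a b, HasDerivAt f (f' x) x) →
      (∀ x, HasDerivAt g (g' x) x) → f a = g a → (∀ x ∈ Icc a b, g' x ≤ f' x) →
      ∀ x ∈ Icc a b, g x ≤ f x := by
    intro f f' g g' hf hg hfg hle x hx
    exact image_le_of_deriv_right_le_deriv_boundary
      (fun x _ => (hg x).continuousAt.continuousWithinAt)
      (fun x _ => (hg x).hasDerivWithinAt) hfg.ge
      (fun x hx => (hf x hx).continuousAt.continuousWithinAt)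
      (fun x hx => (hf x (Ico_subset_Icc_self hx)).hasDerivWithinAt)
      (fun x hx => hle x (Ico_subset_Icc_self hx)) hx
  have s1 : ∀ x ∈ Icc a b, J' a + c * (x - a) ≤ J' x :=
    key h2 (g := fun x => J' a + c * (x - a)) (g' := fun _ => c)
      (fun x => by simpa using (((hasDerivAt_id x).sub_const a).const_mul c).const_add (J' a))
      (by simp) hc
  refine key h1 (g := fun x => J a + J' a * (x - a) + c / 2 * (x - a) ^ 2)
    (g' := fun x => J' a + c * (x - a)) (fun x => ?_) (by simp) s1 b ⟨hab, le_rfl⟩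
  have hx := (hasDerivAt_id x).sub_const a
  refine HasDerivAt.congr_deriv
    (((hx.const_mul (J' a)).const_add (J a)).add ((hx.pow 2).const_mul (c / 2))) ?_
  norm_num
  ring

theorem eq_affine_of_second_deriv_eq_zero {J J' : ℝ → ℝ} (h1 : ∀ x, 0 ≤ x → HasDerivAt J (J' x) x)
    (h2 : ∀ x, 0 ≤ x → HasDerivAt J' 0 x) {ξ : ℝ} (hξ : 0 ≤ ξ) : J ξ = J 0 + J' 0 * ξ := by
  have u := taylor_lower_bound (J'' := fun _ => 0) hξ (fun x hx => h1 x hx.1)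
    (fun x hx => h2 x hx.1) (fun x _ => le_refl (0 : ℝ))
  have l := taylor_lower_bound (J := fun x => -J x) (J' := fun x => -J' x) (J'' := fun _ => 0) hξ
    (fun x hx => (h1 x hx.1).neg) (fun x hx => neg_zero (G := ℝ) ▸ (h2 x hx.1).neg)
    (fun x _ => le_refl (0 : ℝ))
  simp only [sub_zero, zero_div, zero_mul, add_zero] at u l
  linarith

theorem le_chord_add {J J' J'' : ℝ → ℝ} {R c : ℝ}
    (h1 : ∀ x ∈ Icc 0 R, HasDerivAt J (J' x) x) (h2 : ∀ x ∈ Icc 0 R, HasDerivAt J' (J'' x) x)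
    (hc : ∀ x ∈ Icc 0 R, -c ≤ J'' x) {ξ : ℝ} (hξ : 0 ≤ ξ) (hR : ξ < R) :
    R * (J ξ + c / 2 * ξ ^ 2) ≤ (R - ξ) * J 0 + ξ * (J R + c / 2 * R ^ 2) := by
  have hR0 : 0 < R := hξ.trans_lt hR
  have hx2 : ∀ x : ℝ, HasDerivAt (fun x => c / 2 * x ^ 2) (c * x) x := fun x => by
    refine (((hasDerivAt_id x).pow 2).const_mul (c / 2)).congr_deriv ?_
    norm_num
    ring
  have hx1 : ∀ x : ℝ, HasDerivAt (fun x => c * x) c x := fun x => by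
    simpa using (hasDerivAt_id x).const_mul c
  have hconv : ConvexOn ℝ (Icc 0 R) fun x => J x + c / 2 * x ^ 2 :=
    convexOn_of_hasDerivWithinAt2_nonneg (convex_Icc 0 R)
      (fun x hx => ((h1 x hx).add (hx2 x)).continuousAt.continuousWithinAt)
      (fun x hx => ((h1 x (interior_subset hx)).add (hx2 x)).hasDerivWithinAt)
      (fun x hx => ((h2 x (interior_subset hx)).add (hx1 x)).hasDerivWithinAt)
      (fun x hx => by linarith [hc x (interior_subset hx)])
  have h := hconv.2 (left_mem_Icc.2 hR0.le) (right_mem_Icc.2 hR0.le)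
    (sub_nonneg.2 ((div_le_one hR0).2 hR.le)) (div_nonneg hξ hR0.le) (by ring)
  have e : (1 - ξ / R) • (0 : ℝ) + (ξ / R) • R = ξ := by
    simp only [smul_eq_mul]
    field_simp
    ring
  rw [e] at h
  simp only [smul_eq_mul] at h
  have h' := mul_le_mul_of_nonneg_left h hR0.le
  refine h'.trans_eq ?_
  field_simp
  ring

/-- A function of at most quadratic growth has a second derivative that is bounded along a
sequence tending to infinity. -/
theorem exists_second_deriv_le {N N' N'' : ℝ → ℝ} {C : ℝ} (hC : 0 ≤ C)
    (h1 : ∀ x, 0 ≤ x → HasDerivAt N (N' x) x) (h2 : ∀ x, 0 ≤ x → HasDerivAt N' (N'' x) x)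
    (hN0 : ∀ x, 0 ≤ x → 0 ≤ N x) (hN : ∀ x, 0 ≤ x → N x ≤ C * (1 + x) ^ 2) {R : ℝ}
    (hR : 0 ≤ R) : ∃ x, R ≤ x ∧ N'' x ≤ 2 * (C + 1) := by
  by_contra! hcon
  set D := |2 * C * (1 + R) - N' R| with hD
  set G := C * (1 + R) ^ 2
  have hG : 0 ≤ G := by positivity
  have hD0 : 0 ≤ D := abs_nonneg _
  have hD1 : 2 * C * (1 + R) - N' R ≤ D := le_abs_self _
  set h := 1 + D + G with hh
  have hh0 : 0 ≤ h := by positivity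
  have t := taylor_lower_bound (b := R + h) (by linarith) (fun x hx => h1 x (hR.trans hx.1))
    (fun x hx => h2 x (hR.trans hx.1)) (fun x hx => (hcon x hx.1).le)
  have u := hN (R + h) (by positivity)
  have n := hN0 R hR
  have m := mul_le_mul_of_nonneg_right hD1 hh0
  have e : C * (1 + (R + h)) ^ 2 = G + 2 * C * (1 + R) * h + C * h ^ 2 := by ring
  have k : h ^ 2 = h + D * h + G * h := by rw [hh]; ring
  have l : G * 1 ≤ G * h := mul_le_mul_of_nonneg_left (by rw [hh]; linarith) hG
  rw [e] at u
  rw [add_sub_cancel_left] at t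
  nlinarith

theorem Periodic.exists_place {v1 v2 : ℝ × ℝ} (hdet : v1.1 * v2.2 - v1.2 * v2.1 ≠ 0) (p : Pt) :
    ∃ q ∈ Icc (0 : ℝ) 1 ×ˢ Icc (0 : ℝ) 1, ∀ f : Pt → ℝ, Periodic v1 v2 f →
      f p = f (place v1 v2 p.1 q) := by
  set d := v1.1 * v2.2 - v1.2 * v2.1 with hd
  set s := (p.2.1 * v2.2 - p.2.2 * v2.1) / d with hs
  set t := (p.2.2 * v1.1 - p.2.1 * v1.2) / d with ht
  refine ⟨(Int.fract s, Int.fract t),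
    ⟨⟨Int.fract_nonneg s, (Int.fract_lt_one s).le⟩, Int.fract_nonneg t, (Int.fract_lt_one t).le⟩,
    fun f hf => ?_⟩
  have h1 : Function.Periodic f ((0, v1) : Pt) := fun p => (hf p).1
  have h2 : Function.Periodic f ((0, v2) : Pt) := fun p => (hf p).2
  rw [← h1.zsmul ⌊s⌋ (place v1 v2 p.1 (Int.fract s, Int.fract t)),
    ← h2.zsmul ⌊t⌋ (_ + _)]
  congr 1
  have hs' : Int.fract s = s - ⌊s⌋ := rfl
  have ht' : Int.fract t = t - ⌊t⌋ := rfl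
  have x : s * v1.1 + t * v2.1 = p.2.1 := by
    rw [hs, ht]
    field_simp
    rw [hd]
    ring
  have y : s * v1.2 + t * v2.2 = p.2.2 := by
    rw [hs, ht]
    field_simp
    rw [hd]
    ring
  ext
  · simp [place]
  · simp only [place, hs', ht', Prod.snd_add, Prod.fst_add, Prod.smul_snd, Prod.smul_fst]
    simp only [zsmul_eq_mul]
    linear_combination -x
  · simp only [place, hs', ht', Prod.snd_add, Prod.smul_snd]
    simp only [zsmul_eq_mul]
    linear_combination -y

/-- Periodic `C²` solutions of the Toda equation on the half-space `ξ ≥ 0`. -/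
structure IsToda (v1 v2 : ℝ × ℝ) (V : Pt → ℝ) : Prop where
  contDiff : ContDiff ℝ 2 V
  periodic : Periodic v1 v2 V
  toda : ∀ p : Pt, 0 ≤ p.1 → dir (dir (fun p => exp (V p)) e₀) e₀ p +
    dir (dir V e₁) e₁ p + dir (dir V e₂) e₂ p = 0

namespace IsToda

variable {v1 v2 : ℝ × ℝ} {V W : Pt → ℝ}

theorem contDiff_one (hV : IsToda v1 v2 V) : ContDiff ℝ 1 V := hV.contDiff.of_le (by norm_num)

theorem continuous (hV : IsToda v1 v2 V) : Continuous V := hV.contDiff.continuous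

theorem contDiff_exp (hV : IsToda v1 v2 V) : ContDiff ℝ 2 fun p => exp (V p) := hV.contDiff.exp

theorem continuous_exp (hV : IsToda v1 v2 V) : Continuous fun p => exp (V p) :=
  hV.contDiff_exp.continuous

theorem periodic_exp (hV : IsToda v1 v2 V) : Periodic v1 v2 fun p => exp (V p) := fun p => by
  simp only [(hV.periodic p).1, (hV.periodic p).2, and_self]

theorem cellInt_exp_affine (hdet : v1.1 * v2.2 - v1.2 * v2.1 ≠ 0) (hV : IsToda v1 v2 V) :
    ∃ A a : ℝ, ∀ ξ, 0 ≤ ξ → cellInt v1 v2 (fun p => exp (V p)) ξ = A + a * ξ := by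
  have h := hasDerivAt_cellInt_comp hdet hV.contDiff_exp hV.contDiff hV.periodic_exp hV.periodic
    hV.toda contDiff_id
  refine ⟨_, _, fun ξ hξ => eq_affine_of_second_deriv_eq_zero (fun x _ => h.1 x)
    (fun x hx => (h.2 x hx).congr_deriv ?_) hξ⟩
  simp [deriv_id', cellInt]

/-- The density of the weighted Dirichlet energy of a slice. -/
def energyDensity (V : Pt → ℝ) (p : Pt) : ℝ := exp (V p) * (dir V e₁ p ^ 2 + dir V e₂ p ^ 2)

theorem continuous_energyDensity (hV : IsToda v1 v2 V) : Continuous (energyDensity V) :=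
  hV.continuous_exp.mul (((continuous_dir hV.contDiff_one e₁).pow 2).add
    ((continuous_dir hV.contDiff_one e₂).pow 2))

theorem exists_deriv_cellInt_exp_sq (hdet : v1.1 * v2.2 - v1.2 * v2.1 ≠ 0)
    (hV : IsToda v1 v2 V) :
    ∃ N' N'' : ℝ → ℝ, ∀ ξ, 0 ≤ ξ →
      HasDerivAt (cellInt v1 v2 fun p => exp (V p) ^ 2) (N' ξ) ξ ∧ HasDerivAt N' (N'' ξ) ξ ∧
      2 * cellInt v1 v2 (energyDensity V) ξ ≤ N'' ξ := by
  have h := hasDerivAt_cellInt_comp hdet hV.contDiff_exp hV.contDiff hV.periodic_exp hV.periodic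
    hV.toda (P := fun t => t ^ 2) (contDiff_id.pow 2)
  have hd2 : ∀ t : ℝ, deriv (deriv fun t : ℝ => t ^ 2) t = 2 := by
    intro t
    have : (deriv fun t : ℝ => t ^ 2) = fun t => 2 * t := by
      funext t
      simp
    rw [this]
    simp
  refine ⟨_, _, fun ξ hξ => ⟨h.1 ξ, h.2 ξ hξ, ?_⟩⟩
  simp only [hd2]
  rw [cellInt_const_mul]
  have c0 := continuous_dir (hV.contDiff_exp.of_le (by norm_num)) e₀
  have c1 := continuous_dir (hV.contDiff_exp.of_le (by norm_num)) e₁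
  have c2 := continuous_dir (hV.contDiff_exp.of_le (by norm_num)) e₂
  have d1 := continuous_dir hV.contDiff_one e₁
  have d2 := continuous_dir hV.contDiff_one e₂
  refine mul_le_mul_of_nonneg_left (cellInt_mono v1 v2 hV.continuous_energyDensity
    (by fun_prop) fun p _ => ?_) zero_le_two
  rw [dir_exp hV.contDiff_one e₁, dir_exp hV.contDiff_one e₂, energyDensity]
  nlinarith [sq_nonneg (dir (fun p => exp (V p)) e₀ p)]

/-- The mean oscillation of `e ^ V` on a slice. -/
def osc (v1 v2 : ℝ × ℝ) (V : Pt → ℝ) (ξ : ℝ) : ℝ :=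
  cellInt v1 v2 (fun p => |exp (V p) - cellInt v1 v2 (fun p => exp (V p)) ξ|) ξ

theorem osc_le (hV : IsToda v1 v2 V) {η : ℝ} (hη : 0 < η) (ξ : ℝ) :
    osc v1 v2 V ξ ≤ (|v1.1| + |v1.2| + (|v2.1| + |v2.2|)) *
      (η * cellInt v1 v2 (fun p => exp (V p)) ξ + η⁻¹ * cellInt v1 v2 (energyDensity V) ξ) := by
  have hE : ContDiff ℝ 1 fun p => exp (V p) := hV.contDiff_one.exp
  have cE := hV.continuous_exp
  have cD := hV.continuous_energyDensity
  have amgm : ∀ x y : ℝ, |x| ≤ η + η⁻¹ * (x ^ 2 + y ^ 2) := by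
    intro x y
    have h1 : η⁻¹ * η = 1 := inv_mul_cancel₀ hη.ne'
    have h2 : 0 ≤ η⁻¹ * ((|x| - η) ^ 2 + |x| * η + y ^ 2) := by positivity
    have h3 : η⁻¹ * ((|x| - η) ^ 2 + |x| * η + y ^ 2) =
        η⁻¹ * (x ^ 2 + y ^ 2) - (η⁻¹ * η) * |x| + (η⁻¹ * η) * η := by
      rw [← sq_abs x]
      ring
    rw [h3, h1] at h2
    linarith
  have bound : ∀ (a : ℝ × ℝ) (p : Pt), |dir (fun p => exp (V p)) (0, a) p| ≤
      (|a.1| + |a.2|) * (η * exp (V p) + η⁻¹ * energyDensity V p) := by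
    intro a p
    rw [dir_exp hV.contDiff_one, dir_lattice, energyDensity, abs_mul, abs_of_pos (exp_pos _)]
    have h1 := amgm (dir V e₁ p) (dir V e₂ p)
    have h2 := amgm (dir V e₂ p) (dir V e₁ p)
    have h3 : |a.1 * dir V e₁ p + a.2 * dir V e₂ p| ≤
        (|a.1| + |a.2|) * (η + η⁻¹ * (dir V e₁ p ^ 2 + dir V e₂ p ^ 2)) := by
      refine (abs_add_le _ _).trans ?_
      rw [abs_mul, abs_mul, add_mul]
      refine add_le_add (mul_le_mul_of_nonneg_left h1 (abs_nonneg _))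
        (mul_le_mul_of_nonneg_left ?_ (abs_nonneg _))
      rwa [add_comm (dir V e₁ p ^ 2)]
    refine (mul_le_mul_of_nonneg_left h3 (exp_pos (V p)).le).trans_eq ?_
    ring
  have int : ∀ a : ℝ × ℝ, cellInt v1 v2 (fun p => |dir (fun p => exp (V p)) (0, a) p|) ξ ≤
      (|a.1| + |a.2|) * (η * cellInt v1 v2 (fun p => exp (V p)) ξ +
        η⁻¹ * cellInt v1 v2 (energyDensity V) ξ) := by
    intro a
    rw [← cellInt_const_mul, ← cellInt_const_mul, ← cellInt_add v1 v2 (cE.const_mul η)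
      (cD.const_mul η⁻¹), ← cellInt_const_mul]
    exact cellInt_mono v1 v2 (continuous_dir hE _).abs
      (((cE.const_mul η).add (cD.const_mul η⁻¹)).const_mul _) fun p _ => bound a p
  refine (cellInt_abs_sub_mean_le v1 v2 hE ξ).trans ?_
  rw [add_mul]
  exact add_le_add (int v1) (int v2)

/-- Two solutions of at most linear growth have slices arbitrarily far out on which both
are nearly constant relative to their size. -/
theorem exists_osc_le (hdet : v1.1 * v2.2 - v1.2 * v2.1 ≠ 0) (hV : IsToda v1 v2 V)
    (hW : IsToda v1 v2 W) {C : ℝ} (hCV : ∀ p : Pt, 0 ≤ p.1 → exp (V p) ≤ C * (1 + p.1))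
    (hCW : ∀ p : Pt, 0 ≤ p.1 → exp (W p) ≤ C * (1 + p.1)) {δ : ℝ} (hδ : 0 < δ) {R : ℝ}
    (hR : 0 ≤ R) :
    ∃ ξ, R ≤ ξ ∧ osc v1 v2 V ξ ≤ δ * (1 + ξ) ∧ osc v1 v2 W ξ ≤ δ * (1 + ξ) := by
  have hC : 0 < C := by simpa using (exp_pos _).trans_le (hCV 0 le_rfl)
  obtain ⟨N', N'', hN⟩ := hV.exists_deriv_cellInt_exp_sq hdet
  obtain ⟨M', M'', hM⟩ := hW.exists_deriv_cellInt_exp_sq hdet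
  have sq_bound : ∀ U : Pt → ℝ, IsToda v1 v2 U →
      (∀ p : Pt, 0 ≤ p.1 → exp (U p) ≤ C * (1 + p.1)) → ∀ ξ, 0 ≤ ξ →
      cellInt v1 v2 (fun p => exp (U p) ^ 2) ξ ≤ C ^ 2 * (1 + ξ) ^ 2 := by
    intro U hU hCU ξ hξ
    rw [← mul_pow, ← cellInt_const v1 v2 ((C * (1 + ξ)) ^ 2) ξ]
    refine cellInt_mono v1 v2 (hU.continuous_exp.pow 2) continuous_const fun p hp => ?_
    exact pow_le_pow_left₀ (exp_pos _).le (by rw [← hp]; exact hCU p (hp ▸ hξ)) 2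
  have mean_bound : ∀ U : Pt → ℝ, IsToda v1 v2 U →
      (∀ p : Pt, 0 ≤ p.1 → exp (U p) ≤ C * (1 + p.1)) → ∀ ξ, 0 ≤ ξ →
      cellInt v1 v2 (fun p => exp (U p)) ξ ≤ C * (1 + ξ) := by
    intro U hU hCU ξ hξ
    rw [← cellInt_const v1 v2 (C * (1 + ξ)) ξ]
    exact cellInt_mono v1 v2 hU.continuous_exp continuous_const
      fun p hp => by rw [← hp]; exact hCU p (hp ▸ hξ)
  set D := 2 * (2 * C ^ 2 + 1) with hD
  set κ := |v1.1| + |v1.2| + (|v2.1| + |v2.2|) with hκ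
  have hκ0 : 0 ≤ κ := by positivity
  set η := δ / (2 * (κ + 1) * C) with hη
  have hη0 : 0 < η := by positivity
  set S := 2 * κ * (η⁻¹ * D) / δ with hS
  have hS0 : 0 ≤ S := by positivity
  obtain ⟨ξ, hξ, hle⟩ := exists_second_deriv_le (C := 2 * C ^ 2) (by positivity)
    (fun x hx => (hN x hx).1.add (hM x hx).1) (fun x hx => (hN x hx).2.1.add (hM x hx).2.1)
    (fun x _ => add_nonneg (cellInt_nonneg v1 v2 fun p _ => by positivity)
      (cellInt_nonneg v1 v2 fun p _ => by positivity))
    (fun x hx => by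
      have h1 := sq_bound V hV hCV x hx
      have h2 := sq_bound W hW hCW x hx
      simp only [Pi.add_apply]
      linarith) (add_nonneg hR hS0)
  have hξ0 : 0 ≤ ξ := (add_nonneg hR hS0).trans hξ
  have eV := (hN ξ hξ0).2.2
  have eW := (hM ξ hξ0).2.2
  have eV0 : 0 ≤ cellInt v1 v2 (energyDensity V) ξ :=
    cellInt_nonneg v1 v2 fun p _ => by unfold energyDensity; positivity
  have eW0 : 0 ≤ cellInt v1 v2 (energyDensity W) ξ :=
    cellInt_nonneg v1 v2 fun p _ => by unfold energyDensity; positivity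
  have final : ∀ m e : ℝ, m ≤ C * (1 + ξ) → e ≤ D → κ * (η * m + η⁻¹ * e) ≤ δ * (1 + ξ) := by
    intro m e hm he
    have h1 : κ * (η * m) ≤ δ / 2 * (1 + ξ) := by
      calc κ * (η * m) ≤ κ * (η * (C * (1 + ξ))) := by gcongr
        _ ≤ (κ + 1) * (η * (C * (1 + ξ))) := by gcongr; linarith
        _ = δ / 2 * (1 + ξ) := by rw [hη]; field_simp
    have h2 : κ * (η⁻¹ * e) ≤ δ / 2 * (1 + ξ) := by
      calc κ * (η⁻¹ * e) ≤ κ * (η⁻¹ * D) := by gcongr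
        _ = δ / 2 * S := by rw [hS]; field_simp
        _ ≤ δ / 2 * (1 + ξ) := by gcongr; linarith
    linarith
  refine ⟨ξ, by linarith, (hV.osc_le hη0 ξ).trans (final _ _ (mean_bound V hV hCV ξ hξ0) ?_),
    (hW.osc_le hη0 ξ).trans (final _ _ (mean_bound W hW hCW ξ hξ0) ?_)⟩ <;> linarith

/-- A smooth approximation of twice the negative part. -/
def softNeg (ε t : ℝ) : ℝ := √(t ^ 2 + ε ^ 2) - t

theorem contDiff_softNeg {ε : ℝ} (hε : 0 < ε) : ContDiff ℝ 2 (softNeg ε) :=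
  (((contDiff_id.pow 2).add contDiff_const).sqrt fun t => by positivity).sub contDiff_id

theorem deriv_deriv_softNeg {ε : ℝ} (hε : 0 < ε) (t : ℝ) :
    deriv (deriv (softNeg ε)) t = ε ^ 2 / √(t ^ 2 + ε ^ 2) ^ 3 := by
  have pos : ∀ t : ℝ, 0 < t ^ 2 + ε ^ 2 := fun t => by positivity
  have hr : ∀ t : ℝ, HasDerivAt (fun t => √(t ^ 2 + ε ^ 2)) (t / √(t ^ 2 + ε ^ 2)) t := by
    intro t
    refine ((((hasDerivAt_id t).pow 2).add_const (ε ^ 2)).sqrt (pos t).ne').congr_deriv ?_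
    have := (sqrt_pos.2 (pos t)).ne'
    simp
    field_simp
  have h1 : deriv (softNeg ε) = fun t => t / √(t ^ 2 + ε ^ 2) - 1 :=
    funext fun t => ((hr t).sub (hasDerivAt_id t)).deriv
  have hs := sqrt_pos.2 (pos t)
  have hq := sq_sqrt (pos t).le
  have h2 : HasDerivAt (fun t => t / √(t ^ 2 + ε ^ 2) - 1) _ t :=
    ((hasDerivAt_id t).div (hr t) hs.ne').sub_const 1
  rw [h1, h2.deriv]
  simp only [id]
  field_simp
  rw [hq]
  ring

theorem deriv_deriv_softNeg_nonneg {ε : ℝ} (hε : 0 < ε) (t : ℝ) :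
    0 ≤ deriv (deriv (softNeg ε)) t := by
  rw [deriv_deriv_softNeg hε]
  positivity

theorem deriv_deriv_softNeg_mul_sq_le {ε : ℝ} (hε : 0 < ε) (t : ℝ) :
    deriv (deriv (softNeg ε)) t * t ^ 2 ≤ ε := by
  have pos : 0 < t ^ 2 + ε ^ 2 := by positivity
  have hs := sqrt_pos.2 pos
  have hq := sq_sqrt pos.le
  have hε' : ε ≤ √(t ^ 2 + ε ^ 2) := le_sqrt_of_sq_le (by nlinarith)
  rw [deriv_deriv_softNeg hε, div_mul_eq_mul_div, div_le_iff₀ (by positivity)]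
  calc ε ^ 2 * t ^ 2 = ε * ε * t ^ 2 := by ring
    _ ≤ ε * √(t ^ 2 + ε ^ 2) * √(t ^ 2 + ε ^ 2) ^ 2 := by
      refine mul_le_mul (mul_le_mul_of_nonneg_left hε' hε.le) ?_ (sq_nonneg t) (by positivity)
      rw [hq]
      linarith [sq_nonneg ε]
    _ = _ := by ring

theorem abs_sub_le_softNeg (ε t : ℝ) : |t| - t ≤ softNeg ε t := by
  refine sub_le_sub_right ?_ t
  rw [← sqrt_sq_eq_abs]
  exact sqrt_le_sqrt (by nlinarith [sq_nonneg ε])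

theorem softNeg_le {ε : ℝ} (hε : 0 ≤ ε) (t : ℝ) : softNeg ε t ≤ |t| - t + ε := by
  have : √(t ^ 2 + ε ^ 2) ≤ |t| + ε := by
    refine sqrt_le_iff.2 ⟨by positivity, ?_⟩
    nlinarith [sq_abs t, mul_nonneg (abs_nonneg t) hε]
  unfold softNeg
  linarith

theorem integrand_lower_bound {a b f g₁ g₂ w₁ w₂ : ℝ} (ha : 0 ≤ a) (hab : a * b = 1) :
    -(f ^ 2 * (b * (w₁ ^ 2 + w₂ ^ 2))) ≤ (a * g₁ + f * w₁) * g₁ + (a * g₂ + f * w₂) * g₂ := by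
  have key : ∀ g w : ℝ, -(f ^ 2 * (b * w ^ 2)) ≤ (a * g + f * w) * g := by
    intro g w
    have h : (a * g + f * w) * g + f ^ 2 * (b * w ^ 2) =
        a * ((g + b * f * w / 2) ^ 2 + 3 / 4 * (b * f * w) ^ 2) := by
      linear_combination (-(f * w * g) - f ^ 2 * b * w ^ 2) * hab
    have h0 : 0 ≤ a * ((g + b * f * w / 2) ^ 2 + 3 / 4 * (b * f * w) ^ 2) := by positivity
    linarith
  linarith [key g₁ w₁, key g₂ w₂]

/-- Kato's inequality: the integral over the slices of the negative part of `e ^ V - e ^ W` is a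
convex function of the height, so it lies below its chord from `0`. -/
theorem cellInt_negPart_le_chord (hdet : v1.1 * v2.2 - v1.2 * v2.1 ≠ 0) (hV : IsToda v1 v2 V)
    (hW : IsToda v1 v2 W) (h0 : ∀ p : Pt, p.1 = 0 → W p ≤ V p) {ξ R : ℝ} (hξ : 0 ≤ ξ)
    (hR : ξ < R) :
    R * cellInt v1 v2 (fun p => |exp (V p) - exp (W p)| - (exp (V p) - exp (W p))) ξ ≤
      ξ * cellInt v1 v2 (fun p => |exp (V p) - exp (W p)| - (exp (V p) - exp (W p))) R := by
  set f : Pt → ℝ := fun p => exp (V p) - exp (W p) with hf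
  set g : Pt → ℝ := fun p => V p - W p with hg
  have cf : ContDiff ℝ 2 f := hV.contDiff_exp.sub hW.contDiff_exp
  have cg : ContDiff ℝ 2 g := hV.contDiff.sub hW.contDiff
  have V1 := hV.contDiff_one
  have W1 := hW.contDiff_one
  have pf : Periodic v1 v2 f := fun p => by
    simp only [hf, (hV.periodic p).1, (hV.periodic p).2, (hW.periodic p).1, (hW.periodic p).2,
      and_self]
  have pg : Periodic v1 v2 g := fun p => by
    simp only [hg, (hV.periodic p).1, (hV.periodic p).2, (hW.periodic p).1, (hW.periodic p).2,
      and_self]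
  have df : ∀ e, dir f e = fun p => dir (fun p => exp (V p)) e p - dir (fun p => exp (W p)) e p :=
    fun e => dir_sub V1.exp W1.exp e
  have dg : ∀ e, dir g e = fun p => dir V e p - dir W e p := fun e => dir_sub V1 W1 e
  have heq : ∀ p : Pt, 0 ≤ p.1 →
      dir (dir f e₀) e₀ p + dir (dir g e₁) e₁ p + dir (dir g e₂) e₂ p = 0 := by
    intro p hp
    rw [df, dg, dg, dir_sub (contDiff_dir hV.contDiff_exp e₀) (contDiff_dir hW.contDiff_exp e₀),
      dir_sub (contDiff_dir hV.contDiff e₁) (contDiff_dir hW.contDiff e₁),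
      dir_sub (contDiff_dir hV.contDiff e₂) (contDiff_dir hW.contDiff e₂)]
    linear_combination hV.toda p hp - hW.toda p hp
  have cW1 := continuous_dir W1 e₁
  have cW2 := continuous_dir W1 e₂
  have cV := hV.continuous
  obtain ⟨C, hC0, hC⟩ := exists_bound_cell v1 v2
    (f := fun p => exp (-V p) * (dir W e₁ p ^ 2 + dir W e₂ p ^ 2)) (by fun_prop) 0 R
  have main : ∀ ε, 0 < ε →
      R * cellInt v1 v2 (fun p => |f p| - f p) ξ ≤
        ξ * cellInt v1 v2 (fun p => |f p| - f p) R + ε * (R + ξ * (C / 2 * R ^ 2)) := by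
    intro ε hε
    have hP := contDiff_softNeg hε
    have cP : Continuous fun p => softNeg ε (f p) := hP.continuous.comp cf.continuous
    have cP2 : Continuous fun p => deriv (deriv (softNeg ε)) (f p) :=
      ((contDiff_succ_iff_deriv.1 hP).2.2.continuous_deriv le_rfl).comp cf.continuous
    have hJ := hasDerivAt_cellInt_comp hdet cf cg pf pg heq hP
    have f0 := continuous_dir (cf.of_le (by norm_num)) e₀
    have f1 := continuous_dir (cf.of_le (by norm_num)) e₁
    have f2 := continuous_dir (cf.of_le (by norm_num)) e₂
    have g1 := continuous_dir (cg.of_le (by norm_num)) e₁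
    have g2 := continuous_dir (cg.of_le (by norm_num)) e₂
    have hlow : ∀ x ∈ Icc 0 R, -(ε * C) ≤ cellInt v1 v2 (fun p => deriv (deriv (softNeg ε)) (f p) *
        (dir f e₀ p ^ 2 + dir f e₁ p * dir g e₁ p + dir f e₂ p * dir g e₂ p)) x := by
      intro x hx
      rw [← cellInt_const v1 v2 (-(ε * C)) x]
      refine cellInt_mono_of_mem v1 v2 continuous_const (by fun_prop) fun q hq => ?_
      set p := place v1 v2 x q
      have hd := deriv_deriv_softNeg_nonneg hε (f p)
      have hd' := deriv_deriv_softNeg_mul_sq_le hε (f p)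
      have hCp := (le_abs_self _).trans (hC x hx q hq)
      have hexp : exp (V p) * exp (-V p) = 1 := by rw [← exp_add, add_neg_cancel, exp_zero]
      have split : ∀ e, dir f e p = exp (V p) * dir g e p + f p * dir W e p := by
        intro e
        rw [df, dg]
        simp only [dir_exp V1, dir_exp W1, hf]
        ring
      have hb := integrand_lower_bound (f := f p) (g₁ := dir g e₁ p) (g₂ := dir g e₂ p)
        (w₁ := dir W e₁ p) (w₂ := dir W e₂ p) (exp_pos (V p)).le hexp
      rw [← split, ← split] at hb
      have h1 := mul_le_mul_of_nonneg_left
        (hb.trans (le_add_of_nonneg_left (sq_nonneg (dir f e₀ p)))) hd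
      have h2 : deriv (deriv (softNeg ε)) (f p) * f p ^ 2 *
          (exp (-V p) * (dir W e₁ p ^ 2 + dir W e₂ p ^ 2)) ≤ ε * C :=
        mul_le_mul hd' hCp (by positivity) hε.le
      rw [← add_assoc] at h1
      refine le_trans ?_ h1
      linarith
    have chord := le_chord_add (c := ε * C) (fun x _ => hJ.1 x) (fun x hx => hJ.2 x hx.1) hlow
      hξ hR
    have J0 : cellInt v1 v2 (fun p => softNeg ε (f p)) 0 ≤ ε := by
      refine le_of_le_of_eq ?_ (cellInt_const v1 v2 ε 0)
      refine cellInt_mono v1 v2 cP continuous_const fun p hp => ?_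
      have hfp : 0 ≤ f p := sub_nonneg.2 (exp_le_exp.2 (h0 p hp))
      simpa [abs_of_nonneg hfp] using softNeg_le hε.le (f p)
    have cabs : Continuous fun p => |f p| - f p := cf.continuous.abs.sub cf.continuous
    have JR : cellInt v1 v2 (fun p => softNeg ε (f p)) R ≤
        cellInt v1 v2 (fun p => |f p| - f p) R + ε := by
      have := cellInt_add v1 v2 cabs (continuous_const (y := ε)) R
      rw [cellInt_const] at this
      rw [← this]
      exact cellInt_mono v1 v2 cP (cabs.add continuous_const) fun p _ => softNeg_le hε.le (f p)
    have Jξ : cellInt v1 v2 (fun p => |f p| - f p) ξ ≤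
        cellInt v1 v2 (fun p => softNeg ε (f p)) ξ :=
      cellInt_mono v1 v2 cabs cP fun p _ => abs_sub_le_softNeg ε (f p)
    calc R * cellInt v1 v2 (fun p => |f p| - f p) ξ
        ≤ R * (cellInt v1 v2 (fun p => softNeg ε (f p)) ξ + ε * C / 2 * ξ ^ 2) := by
          have : 0 ≤ ε * C / 2 * ξ ^ 2 := by positivity
          exact mul_le_mul_of_nonneg_left (by linarith) (hξ.trans hR.le)
      _ ≤ _ := chord
      _ ≤ (R - ξ) * ε + ξ * (cellInt v1 v2 (fun p => |f p| - f p) R + ε + ε * C / 2 * R ^ 2) :=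
          add_le_add (mul_le_mul_of_nonneg_left J0 (sub_nonneg.2 hR.le))
            (mul_le_mul_of_nonneg_left (by linarith) hξ)
      _ = _ := by ring
  have hK : 0 < R + ξ * (C / 2 * R ^ 2) := by
    have : 0 ≤ ξ * (C / 2 * R ^ 2) := by positivity
    linarith
  refine le_of_forall_pos_le_add fun δ hδ => ?_
  have := main (δ / (R + ξ * (C / 2 * R ^ 2))) (by positivity)
  rwa [div_mul_cancel₀ _ hK.ne'] at this

/-- Comparison principle for solutions of at most linear growth with ordered boundary values and
ordered slice means. -/
theorem comparison (hdet : v1.1 * v2.2 - v1.2 * v2.1 ≠ 0) (hV : IsToda v1 v2 V)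
    (hW : IsToda v1 v2 W) {C : ℝ} (hCV : ∀ p : Pt, 0 ≤ p.1 → exp (V p) ≤ C * (1 + p.1))
    (hCW : ∀ p : Pt, 0 ≤ p.1 → exp (W p) ≤ C * (1 + p.1)) (h0 : ∀ p : Pt, p.1 = 0 → W p ≤ V p)
    (hmean : ∀ ξ, 0 ≤ ξ →
      cellInt v1 v2 (fun p => exp (W p)) ξ ≤ cellInt v1 v2 (fun p => exp (V p)) ξ)
    {p : Pt} (hp : 0 ≤ p.1) : W p ≤ V p := by
  set f : Pt → ℝ := fun p => exp (V p) - exp (W p) with hf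
  have cf : Continuous f := hV.continuous_exp.sub hW.continuous_exp
  have cabs : Continuous fun p => |f p| - f p := cf.abs.sub cf
  set ξ := p.1 with hξ
  have hzero : cellInt v1 v2 (fun p => |f p| - f p) ξ ≤ 0 := by
    refine le_of_forall_pos_le_add fun δ hδ => ?_
    obtain ⟨R, hR, hoV, hoW⟩ := exists_osc_le hdet hV hW hCV hCW
      (δ := δ / (8 * (ξ + 1))) (by positivity) (R := ξ + 1) (by positivity)
    have hR0 : 0 < R := by linarith
    have chord := cellInt_negPart_le_chord hdet hV hW h0 hp (by linarith : ξ < R)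
    have hI : cellInt v1 v2 (fun p => |f p| - f p) R ≤ 2 * (osc v1 v2 V R + osc v1 v2 W R) := by
      have a1 : Continuous fun p => |exp (V p) - cellInt v1 v2 (fun p => exp (V p)) R| :=
        (hV.continuous_exp.sub continuous_const).abs
      have a2 : Continuous fun p => |exp (W p) - cellInt v1 v2 (fun p => exp (W p)) R| :=
        (hW.continuous_exp.sub continuous_const).abs
      rw [osc, osc, ← cellInt_add v1 v2 a1 a2, ← cellInt_const_mul]
      refine cellInt_mono v1 v2 cabs ((a1.add a2).const_mul 2) fun p _ => ?_
      have m := hmean R hR0.le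
      have b1 := neg_abs_le (exp (V p) - cellInt v1 v2 (fun p => exp (V p)) R)
      have b2 := le_abs_self (exp (W p) - cellInt v1 v2 (fun p => exp (W p)) R)
      have b3 := abs_nonneg (exp (V p) - cellInt v1 v2 (fun p => exp (V p)) R)
      have b4 := abs_nonneg (exp (W p) - cellInt v1 v2 (fun p => exp (W p)) R)
      simp only [hf, Pi.add_apply]
      rcases abs_cases (exp (V p) - exp (W p)) with h | h <;> linarith
    have e1 : 2 * (osc v1 v2 V R + osc v1 v2 W R) ≤ R * (δ / (ξ + 1)) := by
      have : δ / (8 * (ξ + 1)) * (1 + R) ≤ δ / (8 * (ξ + 1)) * (2 * R) := by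
        gcongr
        linarith
      have e : δ / (8 * (ξ + 1)) * (2 * R) = R * (δ / (ξ + 1)) / 4 := by
        field_simp
        ring
      linarith
    have e2 : ξ * (δ / (ξ + 1)) ≤ δ := by
      rw [mul_div_assoc', div_le_iff₀ (by positivity)]
      nlinarith
    refine le_of_mul_le_mul_left (chord.trans ?_) hR0
    calc ξ * cellInt v1 v2 (fun p => |f p| - f p) R ≤ ξ * (R * (δ / (ξ + 1))) :=
          mul_le_mul_of_nonneg_left (hI.trans e1) hp
      _ = R * (ξ * (δ / (ξ + 1))) := by ring
      _ ≤ R * (0 + δ) := by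
          rw [zero_add]
          exact mul_le_mul_of_nonneg_left e2 hR0.le
  have hnn : ∀ p, 0 ≤ |f p| - f p := fun p => sub_nonneg.2 (le_abs_self _)
  have hae := (integral_eq_zero_iff_of_nonneg (fun q => hnn (place v1 v2 ξ q))
    (integrable_cell v1 v2 cabs ξ)).1
    (le_antisymm hzero (cellInt_nonneg v1 v2 fun p _ => hnn p))
  rw [squareMeasure_eq] at hae
  have hon := Measure.eqOn_of_ae_eq hae
    (cabs.comp (continuous_place_right v1 v2 ξ)).continuousOn continuousOn_const (by
      rw [interior_prod_eq, interior_Icc, closure_prod_eq, closure_Ioo zero_ne_one])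
  obtain ⟨q, hq, hper⟩ := Periodic.exists_place hdet p
  have hfq : |f (place v1 v2 ξ q)| - f (place v1 v2 ξ q) = 0 := hon hq
  have : 0 ≤ f (place v1 v2 ξ q) := by
    rw [← sub_eq_zero.1 hfq]
    exact abs_nonneg _
  rw [hper V hV.periodic, hper W hW.periodic]
  exact exp_le_exp.1 (sub_nonneg.1 this)

theorem dir_rescale {f : Pt → ℝ} (hf : ContDiff ℝ 1 f) (l c : ℝ) (e p : Pt) :
    dir (fun p => f (l * p.1 + c, p.2)) e p = dir f (l * e.1, e.2) (l * p.1 + c, p.2) := by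
  have hF : ContDiff ℝ 1 fun p : Pt => f (l * p.1 + c, p.2) := hf.comp (by fun_prop)
  have hγ : HasDerivAt (fun t : ℝ => p + t • e) e 0 := by
    simpa using ((hasDerivAt_id (0 : ℝ)).smul_const e).const_add p
  have hγ₁ : HasDerivAt (fun t : ℝ => (p + t • e).1) e.1 0 :=
    (ContinuousLinearMap.fst ℝ ℝ (ℝ × ℝ)).hasFDerivAt.comp_hasDerivAt 0 hγ
  have hγ₂ : HasDerivAt (fun t : ℝ => (p + t • e).2) e.2 0 :=
    (ContinuousLinearMap.snd ℝ ℝ (ℝ × ℝ)).hasFDerivAt.comp_hasDerivAt 0 hγ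
  have hδ : HasDerivAt (fun t : ℝ => ((l * (p + t • e).1 + c, (p + t • e).2) : Pt))
      (l * e.1, e.2) 0 :=
    ((hγ₁.const_mul l).add_const c).prodMk hγ₂
  have h1 := hasDerivAt_comp_line hF hγ
  have h2 := hasDerivAt_comp_line hf hδ
  simpa using h1.unique h2

/-- Translations in `ξ` and scalings `v(ξ) ↦ v(lξ) - 2 log l` preserve the Toda equation. -/
theorem rescale (hV : IsToda v1 v2 V) {l c : ℝ} (hl : 0 < l) (hc : 0 ≤ c) :
    IsToda v1 v2 fun p => V (l * p.1 + c, p.2) - 2 * log l := by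
  have hT : ContDiff ℝ 2 fun p : Pt => ((l * p.1 + c, p.2) : Pt) := by fun_prop
  refine ⟨(hV.contDiff.comp hT).sub contDiff_const, fun p => ?_, fun p hp => ?_⟩
  · have h := hV.periodic (l * p.1 + c, p.2)
    simp only [Prod.mk_add_mk, add_zero] at h
    simp only [Prod.fst_add, Prod.snd_add, add_zero, h.1, h.2, and_self]
  · have hexp : (fun p : Pt => exp (V (l * p.1 + c, p.2) - 2 * log l)) =
        fun p => (l ^ 2)⁻¹ * exp (V (l * p.1 + c, p.2)) := by
      funext p
      rw [exp_sub, two_mul, exp_add, exp_log hl, div_eq_inv_mul, sq]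
    have lin : ∀ (a : ℝ) (f : Pt → ℝ), ContDiff ℝ 1 f → ∀ e,
        dir (fun p => a * f p) e = fun p => a * dir f e p := by
      intro a f hf e
      funext p
      simpa using dir_comp (P := fun t => a * t) (by fun_prop) hf e p
    have resc : ∀ f : Pt → ℝ, ContDiff ℝ 1 f → ∀ e : Pt,
        dir (fun p : Pt => f (l * p.1 + c, p.2)) e =
          fun p => dir f (l * e.1, e.2) (l * p.1 + c, p.2) :=
      fun f hf e => funext fun p => dir_rescale hf l c e p
    have shift : ∀ e, dir (fun p : Pt => V (l * p.1 + c, p.2) - 2 * log l) e =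
        dir (fun p : Pt => V (l * p.1 + c, p.2)) e := by
      intro e
      funext p
      rw [dir, dir, fderiv_sub_const]
    have hT1 : ContDiff ℝ 1 fun p : Pt => ((l * p.1 + c, p.2) : Pt) := by fun_prop
    have E2 := hV.contDiff_exp
    have E1 : ContDiff ℝ 1 fun p => exp (V p) := hV.contDiff_one.exp
    have scale : ∀ f : Pt → ℝ, dir f (l * e₀.1, e₀.2) = fun p => l * dir f e₀ p := by
      intro f
      funext p
      have : ((l * e₀.1, e₀.2) : Pt) = l • e₀ := by ext <;> simp
      rw [dir, this, map_smul, smul_eq_mul, dir]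
    have D1 := contDiff_dir E2 e₀
    have F1 : dir (fun p => exp (V (l * p.1 + c, p.2) - 2 * log l)) e₀ = fun p =>
        (l ^ 2)⁻¹ * (l * dir (fun p => exp (V p)) e₀ (l * p.1 + c, p.2)) := by
      rw [hexp, lin _ (fun p => exp (V (l * p.1 + c, p.2))) (E1.comp hT1),
        resc (fun p => exp (V p)) E1, scale]
    have F2 : dir (fun p => (l ^ 2)⁻¹ * (l * dir (fun p => exp (V p)) e₀ (l * p.1 + c, p.2))) e₀ =
        fun p => (l ^ 2)⁻¹ *
          (l * (l * dir (dir (fun p => exp (V p)) e₀) e₀ (l * p.1 + c, p.2))) := by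
      rw [lin _ (fun p => l * dir (fun p => exp (V p)) e₀ (l * p.1 + c, p.2))
        (contDiff_const.mul (D1.comp hT1)),
        lin _ (fun p => dir (fun p => exp (V p)) e₀ (l * p.1 + c, p.2)) (D1.comp hT1),
        resc _ D1, scale]
    rw [F1, F2, shift, shift, resc _ hV.contDiff_one, resc _ hV.contDiff_one]
    have z1 : ((l * e₁.1, e₁.2) : Pt) = e₁ := by ext <;> simp
    have z2 : ((l * e₂.1, e₂.2) : Pt) = e₂ := by ext <;> simp
    rw [z1, z2, resc _ (contDiff_dir hV.contDiff e₁), resc _ (contDiff_dir hV.contDiff e₂), z1, z2]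
    have := hV.toda (l * p.1 + c, p.2) (by positivity)
    have hl2 : (l ^ 2)⁻¹ * (l * l) = 1 := by field_simp
    dsimp only
    linear_combination this +
      dir (dir (fun p => exp (V p)) e₀) e₀ (l * p.1 + c, p.2) * hl2

theorem rescale_le (hdet : v1.1 * v2.2 - v1.2 * v2.1 ≠ 0) (hV : IsToda v1 v2 V) {C : ℝ}
    (hC : ∀ p : Pt, 0 ≤ p.1 → exp (V p) ≤ C * (1 + p.1)) {B : ℝ} (hB : 0 ≤ B)
    (hVB : ∀ p : Pt, p.1 ∈ Icc (0 : ℝ) 1 → |dir V e₀ p| ≤ B) {l : ℝ} (hl1 : 1 ≤ l) (hl2 : l ≤ 2)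
    {p : Pt} (hp : 0 ≤ p.1) : V (l * p.1 + (l - 1) / (B + 1), p.2) - 2 * log l ≤ V p := by
  have hl0 : 0 < l := by linarith
  set c := (l - 1) / (B + 1) with hc
  have hB1 : 0 < B + 1 := by linarith
  have hc0 : 0 ≤ c := div_nonneg (by linarith) hB1.le
  have hc1 : c ≤ 1 := (div_le_one hB1).2 (by linarith)
  have hBc : B * c ≤ l - 1 := by
    have : (B + 1) * c = l - 1 := mul_div_cancel₀ _ hB1.ne'
    linarith
  have hC0 : 0 < C := by simpa using (exp_pos _).trans_le (hC 0 le_rfl)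
  have hW := hV.rescale hl0 hc0
  have hexp : ∀ p : Pt, exp (V (l * p.1 + c, p.2) - 2 * log l) =
      (l ^ 2)⁻¹ * exp (V (l * p.1 + c, p.2)) := by
    intro p
    rw [exp_sub, two_mul, exp_add, exp_log hl0, div_eq_inv_mul, sq]
  have hinv : (l ^ 2)⁻¹ ≤ 1 := inv_le_one_of_one_le₀ (by nlinarith)
  have h0 : ∀ p : Pt, p.1 = 0 → V (l * p.1 + c, p.2) - 2 * log l ≤ V p := by
    rintro ⟨ξ, y⟩ h
    obtain rfl : ξ = 0 := h
    have hd := norm_image_sub_le_of_norm_deriv_le_segment' (f := fun s => V (s, y)) (a := 0)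
      (b := c) (C := B) (fun s _ => (hasDerivAt_comp_line hV.contDiff_one
        ((hasDerivAt_id s).prodMk (hasDerivAt_const s y))).hasDerivWithinAt)
      (fun s hs => hVB (s, y) ⟨hs.1, hs.2.le.trans hc1⟩) c ⟨hc0, le_rfl⟩
    have hlog : l - 1 ≤ 2 * log l := by
      have h1 := one_sub_inv_le_log_of_pos hl0
      have h2 : l * l⁻¹ = 1 := mul_inv_cancel₀ hl0.ne'
      have h3 : 2⁻¹ ≤ l⁻¹ := inv_anti₀ hl0 hl2
      have h4 : (l - 1) * 2⁻¹ ≤ (l - 1) * l⁻¹ := mul_le_mul_of_nonneg_left h3 (by linarith)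
      linarith
    rw [sub_zero] at hd
    have := (le_abs_self _).trans hd
    simp only [mul_zero, zero_add]
    linarith
  obtain ⟨A, a, hA⟩ := hV.cellInt_exp_affine hdet
  have hmean : ∀ ξ, 0 ≤ ξ → cellInt v1 v2 (fun p => exp (V (l * p.1 + c, p.2) - 2 * log l)) ξ =
      (l ^ 2)⁻¹ * (A + a * (l * ξ + c)) := by
    intro ξ hξ
    rw [← hA _ (by positivity), funext hexp, cellInt_const_mul]
    rfl
  have ha : 0 ≤ a := by
    by_contra! h
    have h1 := hA ((|A| + 1) / -a) (div_nonneg (by positivity) (by linarith))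
    have h2 : 0 ≤ cellInt v1 v2 (fun p => exp (V p)) ((|A| + 1) / -a) :=
      cellInt_nonneg v1 v2 fun p _ => (exp_pos _).le
    have h3 : a * ((|A| + 1) / -a) = -(|A| + 1) := by
      rw [div_neg, mul_neg, mul_div_cancel₀ _ h.ne]
    rw [h1, h3] at h2
    linarith [le_abs_self A]
  have hmean0 := cellInt_mono v1 v2 hW.continuous_exp hV.continuous_exp
    fun p hp => exp_le_exp.2 (h0 p hp)
  rw [hmean 0 le_rfl, hA 0 le_rfl] at hmean0
  refine comparison hdet hV hW (C := 2 * C) (fun p hp => ?_) (fun p hp => ?_) h0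
    (fun ξ hξ => ?_) hp
  · refine (hC p hp).trans ?_
    gcongr
    linarith
  · rw [hexp]
    refine (mul_le_of_le_one_left (exp_pos _).le hinv).trans ((hC _ (by positivity)).trans ?_)
    have : 1 + (l * p.1 + c) ≤ 2 * (1 + p.1) := by nlinarith
    calc C * (1 + (l * p.1 + c)) ≤ C * (2 * (1 + p.1)) := by gcongr
      _ = 2 * C * (1 + p.1) := by ring
  · rw [hmean ξ hξ, hA ξ hξ]
    have e : (l ^ 2)⁻¹ * (a * (l * ξ)) = l⁻¹ * (a * ξ) := by field_simp
    have i : l⁻¹ * (a * ξ) ≤ a * ξ :=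
      mul_le_of_le_one_left (mul_nonneg ha hξ) (inv_le_one_of_one_le₀ hl1)
    linarith

theorem pos_of_growth (hdet : v1.1 * v2.2 - v1.2 * v2.1 ≠ 0) (hV : IsToda v1 v2 V) {C : ℝ}
    (hC : ∀ p : Pt, 0 ≤ p.1 → exp (V p) ≤ C * (1 + p.1)) {p : Pt} (hp : 0 ≤ p.1) :
    0 < 1 - 1 / 2 * p.1 * dir V e₀ p := by
  obtain ⟨B, hB, hVB⟩ := exists_bound_cell v1 v2 (continuous_dir hV.contDiff_one e₀) 0 1
  have hVB' : ∀ p : Pt, p.1 ∈ Icc (0 : ℝ) 1 → |dir V e₀ p| ≤ B := by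
    intro p hp
    obtain ⟨q, hq, hper⟩ := Periodic.exists_place hdet p
    rw [hper _ (hV.periodic.dir e₀)]
    exact hVB p.1 hp q hq
  have hline : HasDerivAt (fun l : ℝ => ((l * p.1 + (l - 1) / (B + 1), p.2) : Pt))
      (p.1 + 1 / (B + 1), 0) 1 := by
    refine HasDerivAt.prodMk ?_ (hasDerivAt_const _ _)
    have h : HasDerivAt (fun l : ℝ => l * p.1 + (l - 1) / (B + 1)) (1 * p.1 + 1 / (B + 1)) 1 :=
      ((hasDerivAt_id (1 : ℝ)).mul_const p.1).add
        (((hasDerivAt_id (1 : ℝ)).sub_const 1).div_const (B + 1))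
    rwa [one_mul] at h
  have hpt : ((1 * p.1 + (1 - 1) / (B + 1), p.2) : Pt) = p := by simp
  have hd := (hasDerivAt_comp_line hV.contDiff_one hline).sub
    ((hasDerivAt_log (one_ne_zero (α := ℝ))).const_mul 2)
  have hle : dir V (p.1 + 1 / (B + 1), 0) p - 2 ≤ 0 := by
    have ht := (hasDerivWithinAt_iff_tendsto_slope' (by simp : (1 : ℝ) ∉ Ioi 1)).1
      (hd.hasDerivWithinAt (s := Ioi 1))
    rw [hpt, inv_one, mul_one] at ht
    refine le_of_tendsto ht ?_
    filter_upwards [Ioo_mem_nhdsGT (by norm_num : (1 : ℝ) < 2)] with l hl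
    rw [slope_def_field]
    refine div_nonpos_of_nonpos_of_nonneg ?_ (sub_nonneg.2 hl.1.le)
    have := hV.rescale_le hdet hC hB hVB' hl.1.le hl.2.le hp
    simp only [Pi.sub_apply, hpt, log_one]
    linarith
  have hsmul : ((p.1 + 1 / (B + 1), 0) : Pt) = (p.1 + 1 / (B + 1)) • e₀ := by ext <;> simp
  rw [dir, hsmul, map_smul, smul_eq_mul] at hle
  change (p.1 + 1 / (B + 1)) * dir V e₀ p - 2 ≤ 0 at hle
  rcases le_or_gt (dir V e₀ p) 0 with h | h
  · nlinarith
  · have : 0 < 1 / (B + 1) * dir V e₀ p := by positivity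
    linarith

end IsToda

theorem isToda_of_isSolBVP2 {v1 v2 : ℝ × ℝ} {φ : ℝ → ℝ → ℝ} {v : ℝ → ℝ → ℝ → ℝ}
    (hv : IsSolBVP2 v1 v2 φ v) : IsToda v1 v2 fun p => v p.1 p.2.1 p.2.2 := by
  obtain ⟨hreg, -, hper, -, htoda⟩ := hv
  set V : Pt → ℝ := fun p => v p.1 p.2.1 p.2.2 with hV
  have l0 : ∀ {f : Pt → ℝ}, ContDiff ℝ 1 f → ∀ ξ x y,
      deriv (fun s => f (s, x, y)) ξ = dir f e₀ (ξ, x, y) := fun hf ξ x y =>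
    (hasDerivAt_comp_line hf ((hasDerivAt_id ξ).prodMk (hasDerivAt_const ξ (x, y)))).deriv
  have l1 : ∀ {f : Pt → ℝ}, ContDiff ℝ 1 f → ∀ ξ x y,
      deriv (fun s => f (ξ, s, y)) x = dir f e₁ (ξ, x, y) := fun hf ξ x y =>
    (hasDerivAt_comp_line hf ((hasDerivAt_const x ξ).prodMk
      ((hasDerivAt_id x).prodMk (hasDerivAt_const x y)))).deriv
  have l2 : ∀ {f : Pt → ℝ}, ContDiff ℝ 1 f → ∀ ξ x y,
      deriv (fun s => f (ξ, x, s)) y = dir f e₂ (ξ, x, y) := fun hf ξ x y =>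
    (hasDerivAt_comp_line hf ((hasDerivAt_const y ξ).prodMk
      ((hasDerivAt_const y x).prodMk (hasDerivAt_id y)))).deriv
  have h1 : ContDiff ℝ 1 V := hreg.of_le (by norm_num)
  have hE : ContDiff ℝ 2 fun p => exp (V p) := hreg.exp
  refine ⟨hreg, fun p => ?_, fun p hp => ?_⟩
  · simpa [hV] using hper p.1 p.2.1 p.2.2
  · obtain ⟨ξ, x, y⟩ := p
    have h := htoda ξ hp x y
    have d0 : deriv (fun s => exp (v s x y)) = fun s => dir (fun p => exp (V p)) e₀ (s, x, y) :=
      funext fun s => l0 h1.exp s x y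
    have d1 : deriv (fun s => v ξ s y) = fun s => dir V e₁ (ξ, s, y) :=
      funext fun s => l1 h1 ξ s y
    have d2 : deriv (fun s => v ξ x s) = fun s => dir V e₂ (ξ, x, s) :=
      funext fun s => l2 h1 ξ x s
    rw [todaOp, d0, d1, d2, l0 (contDiff_dir hE e₀), l1 (contDiff_dir hreg e₁),
      l2 (contDiff_dir hreg e₂)] at h
    exact h

end Toda

/-- Positivity of `W = 1 − (1/2)ξ v_ξ` for solutions of BVP2. -/
theorem stmt9
    (v1 v2 : ℝ × ℝ) (hdet : |v1.1 * v2.2 - v1.2 * v2.1| = 1)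
    (φ : ℝ → ℝ → ℝ)
    (hφreg : ContDiff ℝ (⊤ : ℕ∞) (fun p : ℝ × ℝ => φ p.1 p.2))
    (hφper : LatticePeriodic v1 v2 φ)
    (v : ℝ → ℝ → ℝ → ℝ) (hv : IsSolBVP2 v1 v2 φ v) :
    ∀ ξ ≥ (0:ℝ), ∀ x y : ℝ,
      0 < 1 - (1/2) * ξ * deriv (fun s => v s x y) ξ := by
  intro ξ hξ x y
  have hV := Toda.isToda_of_isSolBVP2 hv
  obtain ⟨-, ⟨M, hM⟩, -, -, -⟩ := hv
  have hdet' : v1.1 * v2.2 - v1.2 * v2.1 ≠ 0 := fun h => by simp [h] at hdet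
  have hgrowth : ∀ p : ℝ × ℝ × ℝ, 0 ≤ p.1 → exp (v p.1 p.2.1 p.2.2) ≤ exp M * (1 + p.1) := by
    intro p hp
    have h := (abs_le.1 (hM p.1 hp p.2.1 p.2.2)).2
    rw [← exp_log (by linarith : 0 < 1 + p.1), ← exp_add]
    exact exp_le_exp.2 (by linarith)
  have hderiv : deriv (fun s => v s x y) ξ =
      Toda.dir (fun p => v p.1 p.2.1 p.2.2) Toda.e₀ (ξ, x, y) :=
    (Toda.hasDerivAt_comp_line hV.contDiff_one
      ((hasDerivAt_id ξ).prodMk (hasDerivAt_const ξ (x, y)))).deriv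
  have := hV.pos_of_growth hdet' hgrowth (p := (ξ, x, y)) hξ
  rwa [← hderiv] at this
end
end
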